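/- arXiv:math/0508282 — 4 statements merged into one kernel-verified Lean document; each statement's English description precedes it below -/
import Mathlib

section
/- Suppose X₁,…,X_p are independent with X_i ~ N(θ_i, σ²d_i) and, independently, Z ~ N(0, σ²I_n); set S = ZᵀZ and W = XᵀC^{-1}D^{-1}X/S. Assume b ≥ 0, e > −p/2 − n/2 − 2, −p/2 − 1 < a < n/2 + e, and that c₁,…,c_p (each c_i ≥ 1) satisfy 0 ≤ (p/2 + a + 1)/(n/2 + e − a) ≤ (2/(n+2)) ( (∑_{i=1}^p d_i^{1−j}/c_i)/(max_{1≤i≤p} d_i^{1−j}/c_i) − 2 ). Then the estimator θ̂_GB = (I − (φ_GB(W)/W) C^{-1}) X satisfies, for every θ ∈ ℝ^p and σ² > 0, E[(θ̂_GB − θ)ᵀ D^{-j} (θ̂_GB − θ)/σ²] ≤ E[(X − θ)ᵀ D^{-j} (X − θ)/σ²] = ∑_{i=1}^p d_i^{1−j}; i.e., θ̂_GB dominates X (and hence is minimax) under the loss L_j. -/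
open MeasureTheory Finset

/-- The Gauss-type hypergeometric integral `∫₀¹ t^s (1-t)^b (1+vt)^{-N} dt`. -/
noncomputable def gbIntegral (s b N v : ℝ) : ℝ :=
  ∫ t in (0:ℝ)..1, t ^ s * (1 - t) ^ b * (1 + v * t) ^ (-N)

/-- The mean of `t` under the density proportional to `t^α (1-t)^b (1+vt)^{-N}` on `[0,1]`. -/
noncomputable def gbRatio (α b N v : ℝ) : ℝ :=
  gbIntegral (α + 1) b N v / gbIntegral α b N v

lemma intervalIntegrable_rpow_mul {s x : ℝ} (hs : -1 < s) (hx : 0 ≤ x) {g : ℝ → ℝ}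
    (hg : ContinuousOn g (Set.Icc 0 x)) :
    IntervalIntegrable (fun t => t ^ s * g t) volume 0 x :=
  (intervalIntegral.intervalIntegrable_rpow' hs).mul_continuousOn (by rwa [Set.uIcc_of_le hx])

lemma one_add_mul_pos {v t : ℝ} (hv : -1 < v) (ht : t ∈ Set.Icc (0:ℝ) 1) : 0 < 1 + v * t := by
  rcases ht.1.eq_or_lt with rfl | h0
  · simp
  · nlinarith [ht.2, mul_pos (show 0 < 1 + v by linarith) h0]

lemma continuousOn_one_add_mul_rpow {v : ℝ} (hv : -1 < v) (N : ℝ) :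
    ContinuousOn (fun t : ℝ => (1 + v * t) ^ N) (Set.Icc 0 1) :=
  ContinuousOn.rpow_const (by fun_prop) fun _ ht => Or.inl (one_add_mul_pos hv ht).ne'

lemma continuous_one_sub_rpow {b : ℝ} (hb : 0 ≤ b) : Continuous fun t : ℝ => (1 - t) ^ b :=
  Continuous.rpow_const (by fun_prop) fun _ => Or.inr hb

lemma gbIntegrand_intervalIntegrable {s b v : ℝ} (hs : -1 < s) (hb : 0 ≤ b) (hv : -1 < v) (N : ℝ) :
    IntervalIntegrable (fun t : ℝ => t ^ s * (1 - t) ^ b * (1 + v * t) ^ (-N)) volume 0 1 := by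
  simp only [mul_assoc]
  exact intervalIntegrable_rpow_mul hs zero_le_one
    ((continuous_one_sub_rpow hb).continuousOn.mul (continuousOn_one_add_mul_rpow hv _))

lemma gbIntegrand_pos {v t : ℝ} (s b N : ℝ) (hv : -1 < v) (ht : t ∈ Set.Ioo (0:ℝ) 1) :
    0 < t ^ s * (1 - t) ^ b * (1 + v * t) ^ (-N) :=
  mul_pos (mul_pos (Real.rpow_pos_of_pos ht.1 _) (Real.rpow_pos_of_pos (by linarith [ht.2]) _))
    (Real.rpow_pos_of_pos (one_add_mul_pos hv ⟨ht.1.le, ht.2.le⟩) _)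

lemma gbIntegral_pos {s b v : ℝ} (hs : -1 < s) (hb : 0 ≤ b) (hv : -1 < v) (N : ℝ) :
    0 < gbIntegral s b N v :=
  intervalIntegral.intervalIntegral_pos_of_pos_on (gbIntegrand_intervalIntegrable hs hb hv N)
    (fun _ ht => gbIntegrand_pos s b N hv ht) one_pos

lemma gbIntegral_succ_lt {s b v : ℝ} (hs : -1 < s) (hb : 0 ≤ b) (hv : -1 < v) (N : ℝ) :
    gbIntegral (s + 1) b N v < gbIntegral s b N v := by
  have h1 := gbIntegrand_intervalIntegrable hs hb hv N
  have h2 := gbIntegrand_intervalIntegrable (s := s + 1) (by linarith) hb hv N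
  rw [← sub_pos, gbIntegral, gbIntegral, ← intervalIntegral.integral_sub h1 h2]
  refine intervalIntegral.intervalIntegral_pos_of_pos_on (h1.sub h2) (fun t ht => ?_) one_pos
  have := gbIntegrand_pos s b N hv ht
  rw [Real.rpow_add_one ht.1.ne']
  nlinarith [mul_pos this (sub_pos.2 ht.2)]

lemma gbRatio_nonneg {α b v : ℝ} (hα : -1 < α) (hb : 0 ≤ b) (hv : -1 < v) (N : ℝ) :
    0 ≤ gbRatio α b N v :=
  (div_pos (gbIntegral_pos (by linarith) hb hv N) (gbIntegral_pos hα hb hv N)).le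

lemma gbRatio_lt_one {α b v : ℝ} (hα : -1 < α) (hb : 0 ≤ b) (hv : -1 < v) (N : ℝ) :
    gbRatio α b N v < 1 :=
  (div_lt_one (gbIntegral_pos hα hb hv N)).2 (gbIntegral_succ_lt hα hb hv N)

lemma hasDerivAt_gbIntegral {s b N v : ℝ} (hs : -1 < s) (hb : 0 ≤ b) (hN : 0 < N) (hv : 0 ≤ v) :
    HasDerivAt (gbIntegral s b N) (-N * gbIntegral (s + 1) b (N + 1) v) v := by
  have key := (intervalIntegral.hasDerivAt_integral_of_dominated_loc_of_deriv_le
    (μ := volume) (a := 0) (b := 1) (x₀ := v) (s := Set.Ioi (-(1/2) : ℝ))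
    (F := fun v t => t ^ s * (1 - t) ^ b * (1 + v * t) ^ (-N))
    (F' := fun v t => t ^ s * (1 - t) ^ b * (t * (-N) * (1 + v * t) ^ (-N - 1)))
    (bound := fun t => t ^ s * (N * (1 / 2) ^ (-N - 1)))
    (Ioi_mem_nhds (by linarith)) ?_ (gbIntegrand_intervalIntegrable hs hb (by linarith) N) ?_ ?_
    ((intervalIntegral.intervalIntegrable_rpow' hs).mul_const _) ?_).2
  · refine key.congr_deriv ?_
    symm
    rw [gbIntegral, ← intervalIntegral.integral_const_mul]
    refine intervalIntegral.integral_congr_ae (Filter.Eventually.of_forall fun t ht => ?_)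
    rw [Set.uIoc_of_le zero_le_one] at ht
    rw [Real.rpow_add_one ht.1.ne', neg_add']
    ring
  · filter_upwards [Ioi_mem_nhds (show (-1 : ℝ) < v by linarith)] with x hx
    have := (gbIntegrand_intervalIntegrable hs hb hx N).aestronglyMeasurable
    rwa [Set.uIoc_of_le zero_le_one]
  · have : Measurable (fun t : ℝ => t ^ s * (1 - t) ^ b * (t * (-N) * (1 + v * t) ^ (-N - 1))) := by
      fun_prop
    exact this.aestronglyMeasurable
  · refine Filter.Eventually.of_forall fun t ht x hx => ?_
    rw [Set.uIoc_of_le zero_le_one] at ht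
    have hx' : -(1/2) < x := hx
    have h12 : 1 / 2 ≤ 1 + x * t := by nlinarith [ht.1, ht.2]
    have h1 : (1 - t) ^ b ≤ 1 := Real.rpow_le_one (by linarith [ht.2]) (by linarith [ht.1]) hb
    have h1' : 0 ≤ (1 - t) ^ b := Real.rpow_nonneg (by linarith [ht.2]) _
    have h2 : (1 + x * t) ^ (-N - 1) ≤ (1 / 2 : ℝ) ^ (-N - 1) :=
      Real.rpow_le_rpow_of_nonpos (by norm_num) h12 (by linarith)
    have h2' : 0 ≤ (1 + x * t) ^ (-N - 1) := Real.rpow_nonneg (by linarith) _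
    have h3 : 0 ≤ t ^ s := Real.rpow_nonneg ht.1.le _
    rw [Real.norm_eq_abs, abs_mul, abs_mul, abs_mul, abs_mul, abs_neg, abs_of_nonneg h1',
      abs_of_nonneg h2', abs_of_nonneg h3, abs_of_pos ht.1, abs_of_pos hN, mul_assoc]
    refine mul_le_mul_of_nonneg_left ?_ h3
    calc (1 - t) ^ b * (t * N * (1 + x * t) ^ (-N - 1))
        ≤ 1 * (1 * N * (1 / 2) ^ (-N - 1)) := by
          have := ht.1.le
          have := ht.2
          gcongr
      _ = _ := by ring
  · refine Filter.Eventually.of_forall fun t ht x hx => ?_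
    rw [Set.uIoc_of_le zero_le_one] at ht
    have hx' : -(1/2) < x := hx
    have h12 : 1 + x * t ≠ 0 := (one_add_mul_pos (by linarith) ⟨ht.1.le, ht.2⟩).ne'
    have h := ((hasDerivAt_id x).mul_const t).const_add 1
    rw [one_mul] at h
    exact (h.rpow_const (Or.inl h12)).const_mul _

lemma mul_gbIntegral_succ_le {s b N v : ℝ} (hs : -1 < s) (hb : 0 ≤ b) (hv : 0 ≤ v) :
    v * gbIntegral (s + 1) b (N + 1) v ≤ gbIntegral s b N v := by
  rw [gbIntegral, gbIntegral, ← intervalIntegral.integral_const_mul]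
  refine intervalIntegral.integral_mono_on_of_le_Ioo zero_le_one
    ((gbIntegrand_intervalIntegrable (by linarith) hb (by linarith) _).const_mul _)
    (gbIntegrand_intervalIntegrable hs hb (by linarith) N) fun t ht => ?_
  have hpos := one_add_mul_pos (show -1 < v by linarith) (Set.Ioo_subset_Icc_self ht)
  have := (gbIntegrand_pos s b (N + 1) (show -1 < v by linarith) ht).le
  have e1 : (1 + v * t) ^ (-N) = (1 + v * t) ^ (-(N + 1)) * (1 + v * t) := by
    rw [← Real.rpow_add_one hpos.ne']; ring_nf
  rw [e1, Real.rpow_add_one ht.1.ne']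
  nlinarith

/-- The derivative of `gbRatio`, written in terms of `gbIntegral`. -/
noncomputable def gbRatioDeriv (α b N v : ℝ) : ℝ :=
  (-N * gbIntegral (α + 1 + 1) b (N + 1) v * gbIntegral α b N v
    - gbIntegral (α + 1) b N v * (-N * gbIntegral (α + 1) b (N + 1) v)) / gbIntegral α b N v ^ 2

lemma hasDerivAt_gbRatio {α b N v : ℝ} (hα : -1 < α) (hb : 0 ≤ b) (hN : 0 < N) (hv : 0 ≤ v) :
    HasDerivAt (gbRatio α b N) (gbRatioDeriv α b N v) v :=
  (hasDerivAt_gbIntegral (by linarith) hb hN hv).div (hasDerivAt_gbIntegral hα hb hN hv)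
    (gbIntegral_pos hα hb (by linarith) N).ne'

lemma abs_mul_gbRatioDeriv_le {α b N v : ℝ} (hα : -1 < α) (hb : 0 ≤ b) (hN : 0 < N) (hv : 0 ≤ v) :
    |v * gbRatioDeriv α b N v| ≤ N := by
  have hv' : -1 < v := by linarith
  have p0 := gbIntegral_pos hα hb hv' N
  have p1 := gbIntegral_pos (s := α + 1) (by linarith) hb hv' N
  have p2 := gbIntegral_pos (s := α + 1) (by linarith) hb hv' (N + 1)
  have p3 := gbIntegral_pos (s := α + 1 + 1) (by linarith) hb hv' (N + 1)
  have l0 := mul_gbIntegral_succ_le (N := N) hα hb hv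
  have l1 := mul_gbIntegral_succ_le (s := α + 1) (N := N) (by linarith) hb hv
  have l2 := gbIntegral_succ_lt hα hb hv' N
  rw [gbRatioDeriv]
  generalize gbIntegral α b N v = A at *
  generalize gbIntegral (α + 1) b N v = B at *
  generalize gbIntegral (α + 1) b (N + 1) v = C at *
  generalize gbIntegral (α + 1 + 1) b (N + 1) v = D at *
  have hD : 0 ≤ v * D := by positivity
  have hC : 0 ≤ v * C := by positivity
  have hBA : B * A ≤ A ^ 2 := by nlinarith
  have t1 : v * D * A ≤ A ^ 2 := by nlinarith
  have t2 : B * (v * C) ≤ A ^ 2 := by nlinarith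
  have t3 : 0 ≤ v * D * A := by positivity
  have t4 : 0 ≤ B * (v * C) := by positivity
  have e1 : v * ((-N * D * A - B * (-N * C)) / A ^ 2)
      = N * ((B * (v * C) - v * D * A) / A ^ 2) := by ring
  have e2 : |(B * (v * C) - v * D * A) / A ^ 2| ≤ 1 := by
    rw [abs_div, abs_of_pos (by positivity : 0 < A ^ 2), div_le_one (by positivity), abs_le]
    constructor <;> linarith
  rw [e1, abs_mul, abs_of_pos hN]
  nlinarith

/-- Rescaling `u = vt` of the integral expressing the deviation of `v * gbRatio` from `m`. -/
lemma gbIntegral_rescale {α b v : ℝ} (hα : -1 < α) (hb : 0 ≤ b) (hv : 0 < v) (N m : ℝ) :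
    v ^ (α + 1) * (v * gbIntegral (α + 1) b N v - m * gbIntegral α b N v) =
      ∫ u in (0:ℝ)..v, (u - m) * (u ^ α * (1 - u / v) ^ b * (1 + u) ^ (-N)) := by
  have h := intervalIntegral.smul_integral_comp_mul_left (a := 0) (b := 1)
    (fun u => (u - m) * (u ^ α * (1 - u / v) ^ b * (1 + u) ^ (-N))) v
  rw [mul_zero, mul_one] at h
  rw [← h, gbIntegral, gbIntegral, ← intervalIntegral.integral_const_mul,
    ← intervalIntegral.integral_const_mul, ← intervalIntegral.integral_sub
      ((gbIntegrand_intervalIntegrable (by linarith) hb (by linarith) N).const_mul _)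
      ((gbIntegrand_intervalIntegrable hα hb (by linarith) N).const_mul _),
    Real.rpow_add_one hv.ne', smul_eq_mul, mul_comm (v ^ α) v, mul_assoc,
    ← intervalIntegral.integral_const_mul]
  congr 1
  refine intervalIntegral.integral_congr_ae (Filter.Eventually.of_forall fun t ht => ?_)
  rw [Set.uIoc_of_le zero_le_one] at ht
  simp only [mul_div_cancel_left₀ t hv.ne']
  rw [Real.rpow_add_one ht.1.ne', Real.mul_rpow hv.le ht.1.le]
  ring

lemma rescaled_intervalIntegrable {α b v x : ℝ} (hα : -1 < α) (hb : 0 ≤ b) (hx : 0 ≤ x)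
    (N m : ℝ) :
    IntervalIntegrable (fun u => (u - m) * (u ^ α * (1 - u / v) ^ b * (1 + u) ^ (-N)))
      volume 0 x := by
  have : ContinuousOn (fun u : ℝ => (u - m) * (1 - u / v) ^ b * (1 + u) ^ (-N))
      (Set.Icc 0 x) := by
    refine ContinuousOn.mul (ContinuousOn.mul (by fun_prop) ?_) ?_
    · exact ContinuousOn.rpow_const (by fun_prop) fun _ _ => Or.inr hb
    · exact ContinuousOn.rpow_const (by fun_prop) fun u hu => Or.inl (by linarith [hu.1])
  refine (intervalIntegrable_rpow_mul hα hx this).congr fun u _ => ?_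
  ring

lemma monotoneOn_mul_gbRatio {α b N : ℝ} (hα : -1 < α) (hb : 0 ≤ b) :
    MonotoneOn (fun v => v * gbRatio α b N v) (Set.Ici 0) := by
  intro v₁ h₁ v₂ h₂ h12
  have h₁ : 0 ≤ v₁ := h₁
  rcases h₁.eq_or_lt with rfl | hv1
  · simpa using mul_nonneg h₂ (gbRatio_nonneg hα hb (show -1 < v₂ by linarith) N)
  have hv2 : 0 < v₂ := by linarith
  have A1 := gbIntegral_pos hα hb (show -1 < v₁ by linarith) N
  have A2 := gbIntegral_pos hα hb (show -1 < v₂ by linarith) N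
  have hr0 := gbRatio_nonneg hα hb (show -1 < v₁ by linarith) N
  have hr1 := gbRatio_lt_one hα hb (show -1 < v₁ by linarith) N
  set m := v₁ * gbRatio α b N v₁ with hm
  have hm0 : 0 ≤ m := by positivity
  have hm1 : m < v₁ := by nlinarith
  have r1 := gbIntegral_rescale hα hb hv1 N m
  have r2 := gbIntegral_rescale hα hb hv2 N m
  have z1 : v₁ * gbIntegral (α + 1) b N v₁ - m * gbIntegral α b N v₁ = 0 := by
    rw [hm, gbRatio]; field_simp; ring
  rw [z1, mul_zero] at r1
  have i1 := rescaled_intervalIntegrable (v := v₁) hα hb hv1.le N m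
  have i2 := rescaled_intervalIntegrable (v := v₂) hα hb hv1.le N m
  have i3 := rescaled_intervalIntegrable (v := v₂) hα hb hv2.le N m
  have i4 := i2.symm.trans i3
  have hm2 : 0 < (1 - m / v₁) ^ b :=
    Real.rpow_pos_of_pos (by rw [sub_pos, div_lt_one hv1]; exact hm1) _
  have tail : 0 ≤ ∫ u in v₁..v₂, (u - m) * (u ^ α * (1 - u / v₂) ^ b * (1 + u) ^ (-N)) := by
    refine intervalIntegral.integral_nonneg h12 fun u hu => ?_
    have : 0 ≤ 1 - u / v₂ := by rw [sub_nonneg, div_le_one hv2]; exact hu.2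
    have : 0 ≤ u := by linarith [hu.1]
    have : 0 ≤ u - m := by linarith [hu.1]
    positivity
  have head : 0 ≤ ∫ u in (0:ℝ)..v₁, (u - m) * (u ^ α * (1 - u / v₂) ^ b * (1 + u) ^ (-N)) := by
    have := intervalIntegral.integral_mono_on hv1.le (i1.const_mul ((1 - m / v₂) ^ b))
      (i2.const_mul ((1 - m / v₁) ^ b)) fun u hu => ?_
    · rw [intervalIntegral.integral_const_mul, intervalIntegral.integral_const_mul, ← r1,
        mul_zero] at this
      exact nonneg_of_mul_nonneg_right this hm2
    · have a1 : 0 ≤ 1 - u / v₁ := by rw [sub_nonneg, div_le_one hv1]; exact hu.2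
      have a2 : 0 ≤ 1 - u / v₂ := by rw [sub_nonneg, div_le_one hv2]; linarith [hu.2]
      have a3 : 0 ≤ 1 - m / v₁ := by rw [sub_nonneg, div_le_one hv1]; linarith
      have a4 : 0 ≤ 1 - m / v₂ := by rw [sub_nonneg, div_le_one hv2]; linarith
      have u0 := hu.1
      have w0 : 0 ≤ u ^ α * (1 + u) ^ (-N) := by positivity
      have hinv : 0 ≤ 1 / v₁ - 1 / v₂ := sub_nonneg.2 (one_div_le_one_div_of_le hv1 h12)
      have expand : (1 - m / v₁) * (1 - u / v₂) - (1 - m / v₂) * (1 - u / v₁)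
          = (u - m) * (1 / v₁ - 1 / v₂) := by ring
      have cmp : 0 ≤ (u - m) *
          (((1 - m / v₁) * (1 - u / v₂)) ^ b - ((1 - m / v₂) * (1 - u / v₁)) ^ b) := by
        rcases le_total m u with h | h
        · refine mul_nonneg (by linarith) (sub_nonneg.2 (Real.rpow_le_rpow (by positivity) ?_ hb))
          nlinarith [mul_nonneg (sub_nonneg.2 h) hinv]
        · refine mul_nonneg_of_nonpos_of_nonpos (by linarith)
            (sub_nonpos.2 (Real.rpow_le_rpow (by positivity) ?_ hb))
          nlinarith [mul_nonneg (sub_nonneg.2 h) hinv]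
      rw [Real.mul_rpow a3 a2, Real.mul_rpow a4 a1] at cmp
      nlinarith [mul_nonneg cmp w0]
  rw [← intervalIntegral.integral_add_adjacent_intervals i2 i4] at r2
  have r3 := nonneg_of_mul_nonneg_right (r2.symm ▸ add_nonneg head tail)
    (Real.rpow_pos_of_pos hv2 (α + 1))
  change m ≤ v₂ * gbRatio α b N v₂
  rw [gbRatio, ← mul_div_assoc, le_div_iff₀ A2]
  linarith

lemma mul_gbRatio_le {α b N v : ℝ} (hα : -1 < α) (hb : 0 ≤ b) (hN : 0 < N - α - 2) (hv : 0 ≤ v) :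
    v * gbRatio α b N v ≤ (α + 1) / (N - α - 2) := by
  have hv' : -1 < v := by linarith
  rcases hv.eq_or_lt with rfl | hv0
  · rw [zero_mul]; exact div_nonneg (by linarith) hN.le
  have i0 := gbIntegrand_intervalIntegrable hα hb hv' N
  have i1 := gbIntegrand_intervalIntegrable (s := α + 1) (by linarith) hb hv' N
  rw [gbRatio, ← mul_div_assoc, div_le_div_iff₀ (gbIntegral_pos hα hb hv' N) hN, ← sub_nonneg]
  have e : (α + 1) * gbIntegral α b N v - v * gbIntegral (α + 1) b N v * (N - α - 2) =
      ∫ t in (0:ℝ)..1, (1 - t) ^ b *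
        (t ^ α * (1 + v * t) ^ (-N) * ((α + 1) - (N - α - 2) * v * t)) := by
    rw [mul_right_comm, gbIntegral, gbIntegral, ← intervalIntegral.integral_const_mul,
      ← intervalIntegral.integral_const_mul,
      ← intervalIntegral.integral_sub (i0.const_mul _) (i1.const_mul _)]
    refine intervalIntegral.integral_congr_ae (Filter.Eventually.of_forall fun t ht => ?_)
    rw [Set.uIoc_of_le zero_le_one] at ht
    rw [Real.rpow_add_one ht.1.ne']
    ring
  rw [e]
  set t₀ := (α + 1) / ((N - α - 2) * v) with ht₀
  have ht₀' : α + 1 = (N - α - 2) * v * t₀ := by rw [ht₀]; field_simp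
  have ht₀0 : 0 < t₀ := div_pos (by linarith) (by positivity)
  have hcoef : 0 < (N - α - 2) * v := by positivity
  rcases le_total 1 t₀ with h | h
  · refine intervalIntegral.integral_nonneg zero_le_one fun t ht => ?_
    have := ht.1
    have : 0 ≤ 1 - t := by linarith [ht.2]
    have : 0 ≤ (α + 1) - (N - α - 2) * v * t := by rw [ht₀']; nlinarith [ht.2]
    positivity
  · have j0 : IntervalIntegrable
        (fun t : ℝ => t ^ α * (1 + v * t) ^ (-N) * ((α + 1) - (N - α - 2) * v * t)) volume 0 1 := by
      simp only [mul_assoc]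
      exact intervalIntegrable_rpow_mul hα zero_le_one
        ((continuousOn_one_add_mul_rpow hv' _).mul (by fun_prop))
    have j1 := j0.continuousOn_mul (continuous_one_sub_rpow hb).continuousOn
    have ftc : ∫ t in (0:ℝ)..1, t ^ α * (1 + v * t) ^ (-N) * ((α + 1) - (N - α - 2) * v * t)
        = (1 + v) ^ (-N + 1) := by
      rw [intervalIntegral.integral_eq_sub_of_hasDerivAt_of_le
        (f := fun t => t ^ (α + 1) * (1 + v * t) ^ (-N + 1)) zero_le_one ?_ ?_ j0]
      · simp [Real.zero_rpow (show α + 1 ≠ 0 by linarith)]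
      · exact ContinuousOn.mul
          (ContinuousOn.rpow_const (by fun_prop) fun _ _ => Or.inr (by linarith))
          (continuousOn_one_add_mul_rpow hv' _)
      · intro t ht
        have hpos := one_add_mul_pos hv' (Set.Ioo_subset_Icc_self ht)
        have h1 := ((hasDerivAt_id t).const_mul v).const_add 1
        have h2 := (Real.hasDerivAt_rpow_const (x := t) (p := α + 1) (Or.inl ht.1.ne')).mul
          (h1.rpow_const (p := -N + 1) (Or.inl hpos.ne'))
        refine h2.congr_deriv ?_
        simp only [id, add_sub_cancel_right, Real.rpow_add_one ht.1.ne',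
          Real.rpow_add_one hpos.ne']
        ring
    have mono := intervalIntegral.integral_mono_on zero_le_one (j0.const_mul ((1 - t₀) ^ b)) j1
      fun t ht => ?_
    · rw [intervalIntegral.integral_const_mul, ftc] at mono
      refine le_trans (mul_nonneg (Real.rpow_nonneg (by linarith) _)
        (Real.rpow_nonneg (by linarith) _)) mono
    · have b1 : 0 ≤ 1 - t := by linarith [ht.2]
      have hpos := one_add_mul_pos hv' ht
      have t0 := ht.1
      have w0 : 0 ≤ t ^ α * (1 + v * t) ^ (-N) := by positivity
      have cmp : 0 ≤ ((1 - t) ^ b - (1 - t₀) ^ b) * (t₀ - t) := by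
        rcases le_total t t₀ with h' | h'
        · exact mul_nonneg (sub_nonneg.2 (Real.rpow_le_rpow (by linarith) (by linarith) hb))
            (by linarith)
        · exact mul_nonneg_of_nonpos_of_nonpos
            (sub_nonpos.2 (Real.rpow_le_rpow (by linarith) (by linarith) hb)) (by linarith)
      rw [ht₀']
      nlinarith [mul_nonneg (mul_nonneg cmp w0) hcoef.le]

/-- The unnormalised density of independent normal variables with means `θ` and variances `τ`. -/
noncomputable def gaussKernel {m : ℕ} (θ τ x : Fin m → ℝ) : ℝ :=
  ∏ i, Real.exp (-(x i - θ i) ^ 2 / (2 * τ i))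

/-- The polynomial `∏ (1 + xᵢ²)`, used as an envelope for domination. -/
def polyEnvelope {m : ℕ} (x : Fin m → ℝ) : ℝ := ∏ i, (1 + x i ^ 2)

lemma one_add_sq_le_polyEnvelope {m : ℕ} (x : Fin m → ℝ) (i : Fin m) :
    1 + x i ^ 2 ≤ polyEnvelope x := by
  classical
  rw [polyEnvelope, ← mul_prod_erase univ _ (mem_univ i)]
  have : (1:ℝ) ≤ ∏ k ∈ univ.erase i, (1 + x k ^ 2) :=
    Finset.one_le_prod fun k _ => by nlinarith [sq_nonneg (x k)]
  nlinarith [sq_nonneg (x i)]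

lemma one_le_polyEnvelope {m : ℕ} (x : Fin m → ℝ) : 1 ≤ polyEnvelope x :=
  Finset.one_le_prod fun k _ => by nlinarith [sq_nonneg (x k)]

lemma sum_sq_le_polyEnvelope {m : ℕ} (x : Fin m → ℝ) : ∑ i, x i ^ 2 ≤ polyEnvelope x := by
  have : ∀ s : Finset (Fin m), 1 + ∑ i ∈ s, x i ^ 2 ≤ ∏ i ∈ s, (1 + x i ^ 2) := by
    classical
    intro s
    induction s using Finset.induction_on with
    | empty => simp
    | insert i s hi ih =>
      rw [sum_insert hi, prod_insert hi]
      have : 0 ≤ ∑ i ∈ s, x i ^ 2 := sum_nonneg fun _ _ => sq_nonneg _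
      nlinarith [sq_nonneg (x i), mul_nonneg (sq_nonneg (x i)) this]
  have := this univ
  rw [polyEnvelope]
  linarith

lemma gaussKernel_pos {m : ℕ} (θ τ x : Fin m → ℝ) : 0 < gaussKernel θ τ x :=
  prod_pos fun _ _ => Real.exp_pos _

@[fun_prop]
lemma measurable_gaussKernel {m : ℕ} (θ τ : Fin m → ℝ) : Measurable (gaussKernel θ τ) := by
  unfold gaussKernel
  fun_prop

lemma integrable_exp_neg_sub_sq {τ : ℝ} (hτ : 0 < τ) (θ : ℝ) :
    Integrable fun u : ℝ => Real.exp (-(u - θ) ^ 2 / (2 * τ)) := by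
  have h := (integrable_exp_neg_mul_sq (b := 1 / (2 * τ)) (by positivity)).comp_sub_right θ
  refine h.congr (Filter.Eventually.of_forall fun u => ?_)
  simp only
  congr 1
  ring

lemma integral_exp_neg_sub_sq (τ θ : ℝ) :
    ∫ u : ℝ, Real.exp (-(u - θ) ^ 2 / (2 * τ)) = √(2 * Real.pi * τ) := by
  rw [integral_sub_right_eq_self (fun u : ℝ => Real.exp (-u ^ 2 / (2 * τ))) θ]
  have := integral_gaussian (1 / (2 * τ))
  rw [show Real.pi / (1 / (2 * τ)) = 2 * Real.pi * τ by rw [div_div_eq_mul_div]; ring] at this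
  rw [← this]
  congr with u
  congr 1
  ring

lemma integral_gaussKernel {m : ℕ} (θ τ : Fin m → ℝ) :
    ∫ x, gaussKernel θ τ x = ∏ i, √(2 * Real.pi * τ i) := by
  rw [prod_congr rfl fun i _ => (integral_exp_neg_sub_sq (τ i) (θ i)).symm]
  exact integral_fintype_prod_eq_prod (fun i u => Real.exp (-(u - θ i) ^ 2 / (2 * τ i)))

lemma integrable_one_add_sq_sq_mul_exp {τ : ℝ} (hτ : 0 < τ) (θ : ℝ) :
    Integrable fun u : ℝ => (1 + u ^ 2) ^ 2 * Real.exp (-(u - θ) ^ 2 / (2 * τ)) := by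
  refine ((integrable_exp_neg_sub_sq (τ := 2 * τ) (by positivity) θ).const_mul
    ((1 + 2 * θ ^ 2 + 16 * τ) ^ 2)).mono' (Measurable.aestronglyMeasurable (by fun_prop))
    (Filter.Eventually.of_forall fun u => ?_)
  set y := (u - θ) ^ 2 / (8 * τ) with hy
  have hy0 : 0 ≤ y := by positivity
  have hyE : (u - θ) ^ 2 = 8 * τ * y := by rw [hy]; field_simp
  have h1 : 1 + u ^ 2 ≤ (1 + 2 * θ ^ 2 + 16 * τ) * Real.exp y := by
    have h2 := Real.add_one_le_exp y
    have h3 : u ^ 2 ≤ 2 * θ ^ 2 + 2 * (u - θ) ^ 2 := by nlinarith [sq_nonneg (u - 2 * θ)]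
    rw [hyE] at h3
    calc 1 + u ^ 2 ≤ (1 + 2 * θ ^ 2 + 16 * τ) * (y + 1) := by
          nlinarith [mul_nonneg (sq_nonneg θ) hy0]
      _ ≤ _ := mul_le_mul_of_nonneg_left h2 (by positivity)
  have e1 : Real.exp (-(u - θ) ^ 2 / (2 * τ)) = Real.exp (-(4 * y)) := by
    rw [hy]; congr 1; field_simp; ring
  have e2 : Real.exp (-(u - θ) ^ 2 / (2 * (2 * τ))) = Real.exp y ^ 2 * Real.exp (-(4 * y)) := by
    rw [← Real.exp_nat_mul, ← Real.exp_add, hy]; congr 1; push_cast; field_simp; ring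
  rw [Real.norm_of_nonneg (by positivity), e1, e2, ← mul_assoc, ← mul_pow]
  gcongr

lemma integrable_polyEnvelope_sq_mul_gaussKernel {m : ℕ} (θ : Fin m → ℝ) {τ : Fin m → ℝ}
    (hτ : ∀ i, 0 < τ i) : Integrable fun x => polyEnvelope x ^ 2 * gaussKernel θ τ x := by
  have h := Integrable.fintype_prod (μ := fun _ : Fin m => (volume : Measure ℝ))
    fun i => integrable_one_add_sq_sq_mul_exp (hτ i) (θ i)
  refine h.congr (Filter.Eventually.of_forall fun x => ?_)
  simp only [polyEnvelope, gaussKernel, prod_mul_distrib, prod_pow]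

lemma integrable_mul_gaussKernel {m : ℕ} (θ : Fin m → ℝ) {τ : Fin m → ℝ}
    (hτ : ∀ i, 0 < τ i) {f : (Fin m → ℝ) → ℝ} (hf : Measurable f) (C : ℝ)
    (hC : ∀ x, |f x| ≤ C * polyEnvelope x ^ 2) :
    Integrable fun x => f x * gaussKernel θ τ x := by
  refine ((integrable_polyEnvelope_sq_mul_gaussKernel θ hτ).const_mul C).mono'
    (Measurable.aestronglyMeasurable (by fun_prop)) (Filter.Eventually.of_forall fun x => ?_)
  rw [norm_mul, Real.norm_of_nonneg (gaussKernel_pos θ τ x).le, Real.norm_eq_abs, ← mul_assoc]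
  exact mul_le_mul_of_nonneg_right (hC x) (gaussKernel_pos θ τ x).le

lemma integrable_mul_gaussKernel_prod {p n : ℕ} (θ : Fin p → ℝ) {τ : Fin p → ℝ}
    (hτ : ∀ i, 0 < τ i) (η : Fin n → ℝ) {ρ : Fin n → ℝ} (hρ : ∀ k, 0 < ρ k)
    {f : (Fin p → ℝ) × (Fin n → ℝ) → ℝ} (hf : Measurable f) (C : ℝ)
    (hC : ∀ q, |f q| ≤ C * (polyEnvelope q.1 ^ 2 * polyEnvelope q.2 ^ 2)) :
    Integrable fun q => f q * (gaussKernel θ τ q.1 * gaussKernel η ρ q.2) := by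
  refine (((integrable_polyEnvelope_sq_mul_gaussKernel θ hτ).mul_prod
    (integrable_polyEnvelope_sq_mul_gaussKernel η hρ)).const_mul C).mono'
    (Measurable.aestronglyMeasurable (by fun_prop)) (Filter.Eventually.of_forall fun q => ?_)
  have h0 : 0 < gaussKernel θ τ q.1 * gaussKernel η ρ q.2 :=
    mul_pos (gaussKernel_pos _ _ _) (gaussKernel_pos _ _ _)
  rw [norm_mul, Real.norm_of_nonneg h0.le, Real.norm_eq_abs]
  calc _ ≤ C * (polyEnvelope q.1 ^ 2 * polyEnvelope q.2 ^ 2) *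
        (gaussKernel θ τ q.1 * gaussKernel η ρ q.2) := mul_le_mul_of_nonneg_right (hC q) h0.le
    _ = _ := by ring

lemma hasDerivAt_gaussKernel_update {m : ℕ} (θ : Fin m → ℝ) {τ : Fin m → ℝ}
    (hτ : ∀ i, 0 < τ i) (i : Fin m) (x : Fin m → ℝ) :
    HasDerivAt (fun u => gaussKernel θ τ (Function.update x i u))
      (-(x i - θ i) / τ i * gaussKernel θ τ x) (x i) := by
  have e : ∀ u, gaussKernel θ τ (Function.update x i u) =
      Real.exp (-(u - θ i) ^ 2 / (2 * τ i)) *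
        ∏ k ∈ univ.erase i, Real.exp (-(x k - θ k) ^ 2 / (2 * τ k)) := by
    intro u
    rw [gaussKernel, ← mul_prod_erase univ _ (mem_univ i), Function.update_self]
    congr 1
    refine prod_congr rfl fun k hk => ?_
    rw [Function.update_of_ne (ne_of_mem_erase hk)]
  have e' := e (x i)
  rw [Function.update_eq_self] at e'
  rw [e', funext e, ← mul_assoc]
  refine HasDerivAt.mul_const ?_ _
  have h := ((((hasDerivAt_id (x i)).sub_const (θ i)).pow 2).neg.div_const (2 * τ i)).exp
  refine h.congr_deriv ?_
  have := (hτ i).ne'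
  simp
  field_simp
  ring

lemma integral_eq_of_forall_slice {m : ℕ} (i : Fin (m + 1)) {F G : (Fin (m + 1) → ℝ) → ℝ}
    (hF : Integrable F) (hG : Integrable G)
    (h : ∀ᵐ y : Fin m → ℝ, ∫ u, F (i.insertNth u y) = ∫ u, G (i.insertNth u y)) :
    ∫ x, F x = ∫ x, G x := by
  have mp := (volume_preserving_piFinSuccAbove (fun _ : Fin (m + 1) => ℝ) i).symm
  have emb := (MeasurableEquiv.piFinSuccAbove (fun _ : Fin (m + 1) => ℝ) i).symm.measurableEmbedding
  have slice : ∀ {H : (Fin (m + 1) → ℝ) → ℝ}, Integrable H →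
      ∫ x, H x = ∫ y : Fin m → ℝ, ∫ u : ℝ, H (i.insertNth u y) := by
    intro H hH
    have h1 := (mp.integrable_comp_emb emb).2 hH
    rw [← mp.integral_comp emb]
    exact integral_prod_symm _ h1
  rw [slice hF, slice hG]
  exact integral_congr_ae h

lemma ae_slice_integrable {m : ℕ} (i : Fin (m + 1)) {F : (Fin (m + 1) → ℝ) → ℝ}
    (hF : Integrable F) : ∀ᵐ y : Fin m → ℝ, Integrable fun u : ℝ => F (i.insertNth u y) := by
  have mp := (volume_preserving_piFinSuccAbove (fun _ : Fin (m + 1) => ℝ) i).symm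
  have emb := (MeasurableEquiv.piFinSuccAbove (fun _ : Fin (m + 1) => ℝ) i).symm.measurableEmbedding
  exact Integrable.prod_left_ae ((mp.integrable_comp_emb emb).2 hF)

/-- Stein's identity for independent normal variables. -/
theorem stein_identity {m : ℕ} (θ : Fin m → ℝ) {τ : Fin m → ℝ} (hτ : ∀ i, 0 < τ i) (i : Fin m)
    {h h' : (Fin m → ℝ) → ℝ}
    (hh : ∀ x, HasDerivAt (fun u => h (Function.update x i u)) (h' x) (x i))
    (i₁ : Integrable fun x => h x * gaussKernel θ τ x)
    (i₂ : Integrable fun x => (x i - θ i) * h x * gaussKernel θ τ x)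
    (i₃ : Integrable fun x => h' x * gaussKernel θ τ x) :
    ∫ x, (x i - θ i) * h x * gaussKernel θ τ x = τ i * ∫ x, h' x * gaussKernel θ τ x := by
  obtain _ | m := m
  · exact i.elim0
  rw [← integral_const_mul]
  refine integral_eq_of_forall_slice i i₂ (i₃.const_mul _) ?_
  filter_upwards [ae_slice_integrable i i₁, ae_slice_integrable i i₂, ae_slice_integrable i i₃]
    with y j₁ j₂ j₃
  have du : ∀ u : ℝ, HasDerivAt (fun u => h (i.insertNth u y)) (h' (i.insertNth u y)) u := by
    intro u
    simpa [Fin.update_insertNth] using hh (i.insertNth u y)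
  have dv : ∀ u : ℝ, HasDerivAt (fun u => gaussKernel θ τ (i.insertNth u y))
      (-(u - θ i) / τ i * gaussKernel θ τ (i.insertNth u y)) u := by
    intro u
    simpa [Fin.update_insertNth] using hasDerivAt_gaussKernel_update θ hτ i (i.insertNth u y)
  have hτi := (hτ i).ne'
  simp only [Fin.insertNth_apply_same] at j₂ ⊢
  have key := integral_mul_deriv_eq_deriv_mul_of_integrable (fun u _ => du u) (fun u _ => dv u)
    ((j₂.const_mul (-(1 / τ i))).congr (Filter.Eventually.of_forall fun u => by
      simp only [Pi.mul_apply]; ring)) j₃ j₁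
  rw [integral_const_mul, ← neg_eq_iff_eq_neg.2 key, ← integral_neg, ← integral_const_mul]
  refine integral_congr_ae (Filter.Eventually.of_forall fun u => ?_)
  simp only
  field_simp

/-- The diagonal quadratic form `∑ xᵢ² / ωᵢ`. -/
noncomputable def diagQuad {m : ℕ} (ω x : Fin m → ℝ) : ℝ := ∑ i, x i ^ 2 / ω i

/-- The residual sum of squares `∑ zₖ²`. -/
def sumSq {m : ℕ} (z : Fin m → ℝ) : ℝ := ∑ k, z k ^ 2

/-- The statistic `W = (∑ xᵢ² / ωᵢ) / ∑ zₖ²`. -/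
noncomputable def ratioStat {p n : ℕ} (ω : Fin p → ℝ) (q : (Fin p → ℝ) × (Fin n → ℝ)) : ℝ :=
  diagQuad ω q.1 / sumSq q.2

/-- The conditions on the shrinkage factor `ψ(w) = φ(w) / w` needed for the domination result:
`φ` is nondecreasing and bounded by `κ`, and `ψ` is a `[0,1]`-valued differentiable function with
`w ψ'(w)` bounded. -/
structure IsShrinkage (ψ : ℝ → ℝ) (κ K : ℝ) : Prop where
  measurable : Measurable ψ
  differentiableAt : ∀ w, 0 ≤ w → DifferentiableAt ℝ ψ w
  nonneg : ∀ w, 0 ≤ w → 0 ≤ ψ w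
  le_one : ∀ w, 0 ≤ w → ψ w ≤ 1
  abs_mul_deriv_le : ∀ w, 0 ≤ w → |w * deriv ψ w| ≤ K
  monotoneOn : MonotoneOn (fun w => w * ψ w) (Set.Ici 0)
  mul_le : ∀ w, 0 ≤ w → w * ψ w ≤ κ

@[fun_prop]
lemma measurable_diagQuad {m : ℕ} (ω : Fin m → ℝ) : Measurable (diagQuad ω) := by
  unfold diagQuad
  fun_prop

@[fun_prop]
lemma measurable_sumSq {m : ℕ} : Measurable (sumSq (m := m)) := by
  unfold sumSq
  fun_prop

@[fun_prop]
lemma measurable_ratioStat {p n : ℕ} (ω : Fin p → ℝ) : Measurable (ratioStat (n := n) ω) := by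
  unfold ratioStat
  fun_prop

lemma sumSq_nonneg {m : ℕ} (z : Fin m → ℝ) : 0 ≤ sumSq z := sum_nonneg fun _ _ => sq_nonneg _

lemma diagQuad_nonneg {m : ℕ} {ω : Fin m → ℝ} (hω : ∀ i, 0 < ω i) (x : Fin m → ℝ) :
    0 ≤ diagQuad ω x :=
  sum_nonneg fun i _ => div_nonneg (sq_nonneg _) (hω i).le

lemma ratioStat_nonneg {p n : ℕ} {ω : Fin p → ℝ} (hω : ∀ i, 0 < ω i)
    (q : (Fin p → ℝ) × (Fin n → ℝ)) : 0 ≤ ratioStat ω q :=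
  div_nonneg (diagQuad_nonneg hω _) (sumSq_nonneg _)

lemma sq_div_le_diagQuad {m : ℕ} {ω : Fin m → ℝ} (hω : ∀ i, 0 < ω i) (x : Fin m → ℝ) (i : Fin m) :
    x i ^ 2 / ω i ≤ diagQuad ω x :=
  single_le_sum (f := fun i => x i ^ 2 / ω i) (fun i _ => div_nonneg (sq_nonneg _) (hω i).le)
    (mem_univ i)

lemma diagQuad_le {m : ℕ} {ω : Fin m → ℝ} (hω : ∀ i, 0 < ω i) (x : Fin m → ℝ) :
    diagQuad ω x ≤ (∑ i, 1 / ω i) * polyEnvelope x := by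
  rw [diagQuad, sum_mul]
  refine sum_le_sum fun i _ => ?_
  have := one_add_sq_le_polyEnvelope x i
  rw [div_eq_mul_one_div, mul_comm]
  exact mul_le_mul_of_nonneg_left (by linarith) (one_div_pos.2 (hω i)).le

lemma ae_sumSq_pos {n : ℕ} (hn : 0 < n) : ∀ᵐ z : Fin n → ℝ, 0 < sumSq z := by
  have : Nonempty (Fin n) := Fin.pos_iff_nonempty.mp hn
  have : ∀ᵐ z : Fin n → ℝ, z ≠ 0 := by simp [ae_iff]
  filter_upwards [this] with z hz
  obtain ⟨k, hk⟩ := Function.ne_iff.1 hz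
  exact sum_pos' (fun _ _ => sq_nonneg _) ⟨k, mem_univ k, by simpa [sq_pos_iff] using hk⟩

lemma ae_prod_sumSq_pos {p n : ℕ} (hn : 0 < n) :
    ∀ᵐ q : (Fin p → ℝ) × (Fin n → ℝ), 0 < sumSq q.2 :=
  Measure.quasiMeasurePreserving_snd.ae (ae_sumSq_pos hn)

lemma hasDerivAt_diagQuad_update {m : ℕ} (ω x : Fin m → ℝ) (i : Fin m) :
    HasDerivAt (fun u => diagQuad ω (Function.update x i u)) (2 * x i / ω i) (x i) := by
  have e : ∀ u, diagQuad ω (Function.update x i u) =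
      u ^ 2 / ω i + ∑ k ∈ univ.erase i, x k ^ 2 / ω k := by
    intro u
    rw [diagQuad, ← add_sum_erase univ _ (mem_univ i), Function.update_self]
    congr 1
    refine sum_congr rfl fun k hk => ?_
    rw [Function.update_of_ne (ne_of_mem_erase hk)]
  rw [funext e]
  simpa using ((hasDerivAt_pow 2 (x i)).div_const (ω i)).add_const
    (∑ k ∈ univ.erase i, x k ^ 2 / ω k)

namespace IsShrinkage

variable {ψ : ℝ → ℝ} {κ K : ℝ}

lemma add_mul_deriv_nonneg (hψ : IsShrinkage ψ κ K) {w : ℝ} (hw : 0 < w) :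
    0 ≤ ψ w + w * deriv ψ w := by
  have h := (hasDerivAt_id w).mul (hψ.differentiableAt w hw.le).hasDerivAt
  have h1 := h.hasDerivWithinAt (s := Set.Ici 0)
  have h2 := hψ.monotoneOn.derivWithin_nonneg (x := w)
  rw [show (fun w => w * ψ w) = id * ψ from rfl,
    h1.derivWithin (uniqueDiffOn_Ici 0 w hw.le)] at h2
  simpa using h2

lemma abs_deriv_mul_le (hψ : IsShrinkage ψ κ K) {p n : ℕ} {ω : Fin p → ℝ}
    (hω : ∀ i, 0 < ω i) (q : (Fin p → ℝ) × (Fin n → ℝ)) (i : Fin p) :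
    |deriv ψ (ratioStat ω q) * (q.1 i ^ 2 / ω i / sumSq q.2)| ≤ K := by
  refine le_trans ?_ (hψ.abs_mul_deriv_le _ (ratioStat_nonneg hω q))
  have h0 : 0 ≤ q.1 i ^ 2 / ω i / sumSq q.2 :=
    div_nonneg (div_nonneg (sq_nonneg _) (hω i).le) (sumSq_nonneg _)
  rw [abs_mul, abs_mul, mul_comm, abs_of_nonneg h0, abs_of_nonneg (ratioStat_nonneg hω q)]
  refine mul_le_mul_of_nonneg_right ?_ (abs_nonneg _)
  exact div_le_div_of_nonneg_right (sq_div_le_diagQuad hω _ i) (sumSq_nonneg _)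

lemma hasDerivAt_update (hψ : IsShrinkage ψ κ K) {p n : ℕ} {ω : Fin p → ℝ}
    (hω : ∀ i, 0 < ω i) (i : Fin p) (x : Fin p → ℝ) (z : Fin n → ℝ) :
    HasDerivAt (fun u => ψ (ratioStat ω (Function.update x i u, z)) * Function.update x i u i)
      (ψ (ratioStat ω (x, z)) + 2 * (deriv ψ (ratioStat ω (x, z)) * (x i ^ 2 / ω i / sumSq z)))
      (x i) := by
  have h1 := (hasDerivAt_diagQuad_update ω x i).div_const (sumSq z)
  have h2 := (hψ.differentiableAt _ (ratioStat_nonneg hω (x, z))).hasDerivAt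
  have h3 : HasDerivAt (fun u => ratioStat ω (Function.update x i u, z))
      (2 * x i / ω i / sumSq z) (x i) := h1
  have h4 := (HasDerivAt.comp_of_eq (x i) h2 h3 (by rw [Function.update_eq_self])).mul
    (hasDerivAt_id (x i))
  simp only [Function.update_self]
  refine h4.congr_deriv ?_
  simp only [Function.comp_apply, Function.update_eq_self, id]
  ring

lemma abs_comp_ratioStat_le_one (hψ : IsShrinkage ψ κ K) {p n : ℕ} {ω : Fin p → ℝ}
    (hω : ∀ i, 0 < ω i) (q : (Fin p → ℝ) × (Fin n → ℝ)) : |ψ (ratioStat ω q)| ≤ 1 := by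
  rw [abs_of_nonneg (hψ.nonneg _ (ratioStat_nonneg hω q))]
  exact hψ.le_one _ (ratioStat_nonneg hω q)

lemma abs_cross_le (hψ : IsShrinkage ψ κ K) {p n : ℕ} {ω : Fin p → ℝ} (hω : ∀ i, 0 < ω i)
    (a : ℝ) (i : Fin p) (q : (Fin p → ℝ) × (Fin n → ℝ)) :
    |(q.1 i - a) * (ψ (ratioStat ω q) * q.1 i)| ≤ (1 + |a|) * polyEnvelope q.1 ^ 2 := by
  have h1 := hψ.abs_comp_ratioStat_le_one hω q
  have h2 := one_add_sq_le_polyEnvelope q.1 i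
  have h3 : |q.1 i| ≤ polyEnvelope q.1 := by nlinarith [sq_abs (q.1 i), sq_nonneg (|q.1 i| - 1)]
  have h4 := one_le_polyEnvelope q.1
  have h5 : |q.1 i - a| ≤ (1 + |a|) * polyEnvelope q.1 := by
    have := abs_sub (q.1 i) a
    nlinarith [abs_nonneg a]
  rw [abs_mul, abs_mul]
  calc |q.1 i - a| * (|ψ (ratioStat ω q)| * |q.1 i|)
      ≤ ((1 + |a|) * polyEnvelope q.1) * (1 * polyEnvelope q.1) := by gcongr
    _ = _ := by ring

lemma abs_divergence_le (hψ : IsShrinkage ψ κ K) {p n : ℕ} {ω : Fin p → ℝ} (hω : ∀ i, 0 < ω i)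
    (i : Fin p) (q : (Fin p → ℝ) × (Fin n → ℝ)) :
    |ψ (ratioStat ω q) + 2 * (deriv ψ (ratioStat ω q) * (q.1 i ^ 2 / ω i / sumSq q.2))| ≤
      1 + 2 * K := by
  have h1 := abs_le.1 (hψ.abs_comp_ratioStat_le_one hω q)
  have h2 := abs_le.1 (hψ.abs_deriv_mul_le hω q i)
  rw [abs_le]
  constructor <;> linarith [h1.1, h1.2, h2.1, h2.2]

end IsShrinkage

lemma le_mul_polyEnvelope_sq {m : ℕ} {C : ℝ} (hC : 0 ≤ C) (x : Fin m → ℝ) :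
    C ≤ C * polyEnvelope x ^ 2 :=
  le_mul_of_one_le_right hC (one_le_pow₀ (one_le_polyEnvelope x))

lemma le_mul_polyEnvelope_sq_mul {p n : ℕ} {C : ℝ} (hC : 0 ≤ C) (q : (Fin p → ℝ) × (Fin n → ℝ)) :
    C ≤ C * (polyEnvelope q.1 ^ 2 * polyEnvelope q.2 ^ 2) := by
  rw [← mul_assoc]
  exact (le_mul_polyEnvelope_sq hC q.1).trans
    (le_mul_polyEnvelope_sq (mul_nonneg hC (sq_nonneg _)) q.2)

/-- The second moment identity `E[S²] = (n+2) σ² E[S]` for `S = ∑ zₖ²`. -/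
lemma integral_sumSq_mul_sub {n : ℕ} {v : ℝ} (hv : 0 < v) :
    ∫ z : Fin n → ℝ, sumSq z * (sumSq z - ((n : ℝ) + 2) * v) *
      gaussKernel (fun _ => 0) (fun _ => v) z = 0 := by
  set g : (Fin n → ℝ) → ℝ := gaussKernel (fun _ => 0) (fun _ => v)
  have hτ : ∀ _ : Fin n, 0 < v := fun _ => hv
  have envsq : ∀ z : Fin n → ℝ, polyEnvelope z ≤ polyEnvelope z ^ 2 := fun z => by
    nlinarith [one_le_polyEnvelope z]
  have absk : ∀ (z : Fin n → ℝ) k, |z k| ≤ polyEnvelope z := fun z k => by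
    nlinarith [sq_abs (z k), sq_nonneg (|z k| - 1), one_add_sq_le_polyEnvelope z k]
  have sqk : ∀ (z : Fin n → ℝ) k, z k ^ 2 ≤ polyEnvelope z := fun z k => by
    linarith [one_add_sq_le_polyEnvelope z k]
  have hS : Integrable fun z => sumSq z * g z :=
    integrable_mul_gaussKernel _ hτ (by fun_prop) 1 fun z => by
      rw [abs_of_nonneg (sumSq_nonneg z), one_mul]
      exact (sum_sq_le_polyEnvelope z).trans (envsq z)
  have hk : ∀ k, Integrable fun z : Fin n → ℝ => z k ^ 2 * g z := fun k =>
    integrable_mul_gaussKernel _ hτ (by fun_prop) 1 fun z => by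
      rw [abs_of_nonneg (sq_nonneg _), one_mul]
      exact (sqk z k).trans (envsq z)
  have hkS : ∀ k, Integrable fun z : Fin n → ℝ => (z k - 0) * (z k * sumSq z) * g z := fun k =>
    integrable_mul_gaussKernel _ hτ (by fun_prop) 1 fun z => by
      have : (z k - 0) * (z k * sumSq z) = z k ^ 2 * sumSq z := by ring
      rw [this, abs_of_nonneg (mul_nonneg (sq_nonneg _) (sumSq_nonneg z)), one_mul, sq (polyEnvelope z)]
      exact mul_le_mul (sqk z k) (sum_sq_le_polyEnvelope z) (sumSq_nonneg z)
        (by linarith [one_le_polyEnvelope z])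
  have stein : ∀ k, ∫ z : Fin n → ℝ, (z k - 0) * (z k * sumSq z) * g z =
      v * (∫ z, sumSq z * g z) + v * (2 * ∫ z : Fin n → ℝ, z k ^ 2 * g z) := by
    intro k
    have h3 : Integrable fun z : Fin n → ℝ => (sumSq z + 2 * z k ^ 2) * g z :=
      (hS.add ((hk k).const_mul 2)).congr (Filter.Eventually.of_forall fun z => by
        simp only [Pi.add_apply]; ring)
    have := stein_identity (fun _ => 0) hτ k (h := fun z => z k * sumSq z)
      (h' := fun z => sumSq z + 2 * z k ^ 2) ?_ ?_ (hkS k) h3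
    · rw [this, ← mul_add, ← integral_const_mul 2, ← integral_add hS ((hk k).const_mul 2)]
      congr 2
      ext z
      simp only [g]
      ring
    · intro z
      have e : ∀ z : Fin n → ℝ, sumSq z = diagQuad (fun _ => 1) z := fun z => by
        simp [sumSq, diagQuad]
      have h1 := (hasDerivAt_id (z k)).mul (hasDerivAt_diagQuad_update (fun _ => 1) z k)
      simp only [Function.update_self, e]
      refine h1.congr_deriv ?_
      simp only [id, Function.update_eq_self]
      ring
    · refine integrable_mul_gaussKernel _ hτ (by fun_prop) 1 fun z => ?_
      rw [abs_mul, abs_of_nonneg (sumSq_nonneg z), one_mul, sq (polyEnvelope z)]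
      exact mul_le_mul (absk z k) (sum_sq_le_polyEnvelope z) (sumSq_nonneg z)
        (by linarith [one_le_polyEnvelope z])
  have total : ∫ z : Fin n → ℝ, sumSq z * sumSq z * g z =
      ((n : ℝ) + 2) * v * ∫ z, sumSq z * g z := by
    have e1 : ∀ z : Fin n → ℝ, sumSq z * sumSq z * g z =
        ∑ k, (z k - 0) * (z k * sumSq z) * g z := fun z => by
      rw [← sum_mul]
      congr 1
      conv_lhs => rw [sumSq, sum_mul]
      exact sum_congr rfl fun k _ => by rw [sumSq]; ring
    have e2 : ∑ k, ∫ z : Fin n → ℝ, z k ^ 2 * g z = ∫ z, sumSq z * g z := by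
      rw [← integral_finsetSum _ fun k _ => hk k]
      simp only [sumSq, sum_mul]
    simp only [e1]
    rw [integral_finsetSum _ fun k _ => hkS k, sum_congr rfl fun k _ => stein k,
      sum_add_distrib, ← mul_sum, ← mul_sum, ← mul_sum, e2]
    simp
    ring
  have hSS : Integrable fun z : Fin n → ℝ => sumSq z * sumSq z * g z :=
    integrable_mul_gaussKernel _ hτ (by fun_prop) 1 fun z => by
      rw [abs_of_nonneg (mul_nonneg (sumSq_nonneg z) (sumSq_nonneg z)), one_mul, sq (polyEnvelope z)]
      exact mul_le_mul (sum_sq_le_polyEnvelope z) (sum_sq_le_polyEnvelope z) (sumSq_nonneg z)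
        (by linarith [one_le_polyEnvelope z])
  have e3 : ∀ z : Fin n → ℝ, sumSq z * (sumSq z - ((n : ℝ) + 2) * v) * g z =
      sumSq z * sumSq z * g z - ((n : ℝ) + 2) * v * (sumSq z * g z) := fun z => by ring
  simp only [e3]
  rw [integral_sub hSS (hS.const_mul _), integral_const_mul, total, sub_self]

namespace IsShrinkage

variable {ψ : ℝ → ℝ} {κ K : ℝ}

lemma integrable_cross (hψ : IsShrinkage ψ κ K) {p n : ℕ} {ω : Fin p → ℝ}
    (hω : ∀ i, 0 < ω i) (θ : Fin p → ℝ) {τ : Fin p → ℝ} (hτ : ∀ i, 0 < τ i) {v : ℝ} (hv : 0 < v)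
    (i : Fin p) :
    Integrable fun q : (Fin p → ℝ) × (Fin n → ℝ) =>
      (q.1 i - θ i) * (ψ (ratioStat ω q) * q.1 i) *
        (gaussKernel θ τ q.1 * gaussKernel (fun _ => 0) (fun _ => v) q.2) := by
  have hm := hψ.measurable
  refine integrable_mul_gaussKernel_prod θ hτ _ (fun _ => hv) (by fun_prop) (1 + |θ i|) fun q => ?_
  exact (hψ.abs_cross_le hω _ i q).trans
    ((le_mul_polyEnvelope_sq (by positivity) q.2).trans_eq (mul_assoc _ _ _))

lemma integrable_divergence (hψ : IsShrinkage ψ κ K) {p n : ℕ} {ω : Fin p → ℝ}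
    (hω : ∀ i, 0 < ω i) (θ : Fin p → ℝ) {τ : Fin p → ℝ} (hτ : ∀ i, 0 < τ i) {v : ℝ} (hv : 0 < v)
    (i : Fin p) :
    Integrable fun q : (Fin p → ℝ) × (Fin n → ℝ) =>
      (ψ (ratioStat ω q) + 2 * (deriv ψ (ratioStat ω q) * (q.1 i ^ 2 / ω i / sumSq q.2))) *
        (gaussKernel θ τ q.1 * gaussKernel (fun _ => 0) (fun _ => v) q.2) := by
  have hm := hψ.measurable
  have hm' := measurable_deriv ψ
  refine integrable_mul_gaussKernel_prod θ hτ _ (fun _ => hv) (by fun_prop) (1 + 2 * K) fun q => ?_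
  have := hψ.abs_divergence_le hω i q
  exact this.trans (le_mul_polyEnvelope_sq_mul ((abs_nonneg _).trans this) q)

/-- Stein's identity for the shrinkage term `ψ(W) xᵢ`. -/
lemma integral_cross (hψ : IsShrinkage ψ κ K) {p n : ℕ} {ω : Fin p → ℝ}
    (hω : ∀ i, 0 < ω i) (θ : Fin p → ℝ) {τ : Fin p → ℝ} (hτ : ∀ i, 0 < τ i) {v : ℝ} (hv : 0 < v)
    (i : Fin p) :
    ∫ q : (Fin p → ℝ) × (Fin n → ℝ), (q.1 i - θ i) * (ψ (ratioStat ω q) * q.1 i) *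
        (gaussKernel θ τ q.1 * gaussKernel (fun _ => 0) (fun _ => v) q.2) =
      τ i * ∫ q : (Fin p → ℝ) × (Fin n → ℝ),
        (ψ (ratioStat ω q) + 2 * (deriv ψ (ratioStat ω q) * (q.1 i ^ 2 / ω i / sumSq q.2))) *
          (gaussKernel θ τ q.1 * gaussKernel (fun _ => 0) (fun _ => v) q.2) := by
  have hm := hψ.measurable
  have hm' := measurable_deriv ψ
  have I1 := hψ.integrable_cross (n := n) hω θ hτ hv i
  have I2 := hψ.integrable_divergence (n := n) hω θ hτ hv i
  rw [Measure.volume_eq_prod] at I1 I2 ⊢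
  rw [integral_prod_symm _ I1, integral_prod_symm _ I2, ← integral_const_mul]
  refine integral_congr_ae (Filter.Eventually.of_forall fun z => ?_)
  simp only [← mul_assoc _ _ (gaussKernel (fun _ => 0) (fun _ => v) z), integral_mul_const]
  congr 1
  have st := stein_identity θ hτ i (h := fun x => ψ (ratioStat ω (x, z)) * x i)
    (h' := fun x => ψ (ratioStat ω (x, z)) +
      2 * (deriv ψ (ratioStat ω (x, z)) * (x i ^ 2 / ω i / sumSq z)))
    (fun x => hψ.hasDerivAt_update hω i x z) ?_ ?_ ?_
  · simpa only [mul_assoc] using st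
  · refine integrable_mul_gaussKernel θ hτ (by fun_prop) 1 fun x => ?_
    have h1 := hψ.abs_comp_ratioStat_le_one hω (x, z)
    have h2 := one_add_sq_le_polyEnvelope x i
    have h3 : |x i| ≤ polyEnvelope x := by nlinarith [sq_abs (x i), sq_nonneg (|x i| - 1)]
    have h4 := one_le_polyEnvelope x
    rw [abs_mul, one_mul, sq (polyEnvelope x)]
    exact mul_le_mul (h1.trans h4) h3 (abs_nonneg _) (by linarith)
  · exact integrable_mul_gaussKernel θ hτ (by fun_prop) _ fun x => hψ.abs_cross_le hω (θ i) i (x, z)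
  · refine integrable_mul_gaussKernel θ hτ (by fun_prop) (1 + 2 * K) fun x => ?_
    have := hψ.abs_divergence_le hω i (x, z)
    exact this.trans (le_mul_polyEnvelope_sq ((abs_nonneg _).trans this) x)

lemma sum_divergence_ge (hψ : IsShrinkage ψ κ K) {p n : ℕ} {ω : Fin p → ℝ}
    (hω : ∀ i, 0 < ω i) {μ : Fin p → ℝ} {M : ℝ} (hμ : ∀ i, 0 ≤ μ i)
    (hM : ∀ i, μ i ≤ M) (hM0 : 0 ≤ M) {q : (Fin p → ℝ) × (Fin n → ℝ)} (hq : 0 < sumSq q.2) :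
    (∑ i, μ i - 2 * M) * ψ (ratioStat ω q) ≤
      ∑ i, μ i * (ψ (ratioStat ω q) +
        2 * (deriv ψ (ratioStat ω q) * (q.1 i ^ 2 / ω i / sumSq q.2))) := by
  have hψ0 := hψ.nonneg _ (ratioStat_nonneg hω q)
  simp only [mul_add, sum_add_distrib, ← sum_mul]
  have hξ : ∀ i, 0 ≤ q.1 i ^ 2 / ω i := fun i => div_nonneg (sq_nonneg _) (hω i).le
  have e1 : ∑ i, μ i * (2 * (deriv ψ (ratioStat ω q) * (q.1 i ^ 2 / ω i / sumSq q.2))) =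
      2 * (deriv ψ (ratioStat ω q) / sumSq q.2 * ∑ i, μ i * (q.1 i ^ 2 / ω i)) := by
    rw [mul_sum, mul_sum]
    exact sum_congr rfl fun i _ => by ring
  rw [e1]
  set A := ∑ i, μ i * (q.1 i ^ 2 / ω i) with hA
  have hA0 : 0 ≤ A := sum_nonneg fun i _ => mul_nonneg (hμ i) (hξ i)
  have hAM : A ≤ M * diagQuad ω q.1 := by
    rw [hA, diagQuad, mul_sum]
    exact sum_le_sum fun i _ => mul_le_mul_of_nonneg_right (hM i) (hξ i)
  suffices h : -(M * ψ (ratioStat ω q)) ≤ deriv ψ (ratioStat ω q) / sumSq q.2 * A by linarith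
  rcases (diagQuad_nonneg hω q.1).eq_or_lt with hQ | hQ
  · have : A = 0 := le_antisymm (by rw [← hQ, mul_zero] at hAM; exact hAM) hA0
    rw [this, mul_zero]
    exact neg_nonpos.2 (mul_nonneg hM0 hψ0)
  · have hW : 0 < ratioStat ω q := div_pos hQ hq
    have hd := hψ.add_mul_deriv_nonneg hW
    have e2 : deriv ψ (ratioStat ω q) / sumSq q.2 * A =
        ratioStat ω q * deriv ψ (ratioStat ω q) * (A / diagQuad ω q.1) := by
      generalize deriv ψ (ratioStat ω q) = D
      rw [ratioStat]; field_simp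
    have hAQ : A / diagQuad ω q.1 ≤ M := (div_le_iff₀ hQ).2 hAM
    have hAQ0 : 0 ≤ A / diagQuad ω q.1 := div_nonneg hA0 hQ.le
    rw [e2]
    nlinarith [mul_nonneg hd hAQ0, mul_nonneg hψ0 (sub_nonneg.2 hAQ)]

lemma quad_mul_sq_sub_le (hψ : IsShrinkage ψ κ K) {p n : ℕ} {ω : Fin p → ℝ}
    (hω : ∀ i, 0 < ω i) {s : ℝ} (hs : 0 < s) {q : (Fin p → ℝ) × (Fin n → ℝ)}
    (hq : 0 < sumSq q.2) :
    diagQuad ω q.1 * ψ (ratioStat ω q) ^ 2 - s * (ratioStat ω q * ψ (ratioStat ω q) ^ 2) ≤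
      diagQuad ω q.1 * ψ (diagQuad ω q.1 / s) ^ 2 / s ^ 2 * (sumSq q.2 * (sumSq q.2 - s)) := by
  rw [ratioStat]
  generalize sumSq q.2 = S at *
  have hQ0 := diagQuad_nonneg hω q.1
  generalize diagQuad ω q.1 = Q at *
  rcases hQ0.eq_or_lt with rfl | hQ
  · simp
  have hφ : ∀ t, 0 < t → 0 ≤ Q / t * ψ (Q / t) := fun t ht =>
    mul_nonneg (by positivity) (hψ.nonneg _ (by positivity))
  have e1 : Q * ψ (Q / S) ^ 2 - s * (Q / S * ψ (Q / S) ^ 2) =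
      (Q / S * ψ (Q / S)) ^ 2 * (S * (S - s) / Q) := by field_simp
  have e2 : Q * ψ (Q / s) ^ 2 / s ^ 2 * (S * (S - s)) =
      (Q / s * ψ (Q / s)) ^ 2 * (S * (S - s) / Q) := by field_simp
  rw [e1, e2]
  rcases le_total s S with h | h
  · have := hψ.monotoneOn (show Q / S ∈ Set.Ici 0 from (by positivity : 0 ≤ Q / S))
      (show Q / s ∈ Set.Ici 0 from (by positivity : 0 ≤ Q / s)) (by gcongr)
    refine mul_le_mul_of_nonneg_right (pow_le_pow_left₀ (hφ S hq) this 2) ?_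
    exact div_nonneg (mul_nonneg hq.le (by linarith)) hQ.le
  · have := hψ.monotoneOn (show Q / s ∈ Set.Ici 0 from (by positivity : 0 ≤ Q / s))
      (show Q / S ∈ Set.Ici 0 from (by positivity : 0 ≤ Q / S)) (by gcongr)
    refine mul_le_mul_of_nonpos_right (pow_le_pow_left₀ (hφ s hs) this 2) ?_
    exact div_nonpos_of_nonpos_of_nonneg (mul_nonpos_of_nonneg_of_nonpos hq.le (by linarith)) hQ.le

lemma integrable_quad_mul_sq (hψ : IsShrinkage ψ κ K) {p n : ℕ} {ω : Fin p → ℝ}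
    (hω : ∀ i, 0 < ω i) (θ : Fin p → ℝ) {τ : Fin p → ℝ} (hτ : ∀ i, 0 < τ i) {v : ℝ} (hv : 0 < v) :
    Integrable fun q : (Fin p → ℝ) × (Fin n → ℝ) => diagQuad ω q.1 * ψ (ratioStat ω q) ^ 2 *
        (gaussKernel θ τ q.1 * gaussKernel (fun _ => 0) (fun _ => v) q.2) := by
  have hm := hψ.measurable
  refine integrable_mul_gaussKernel_prod θ hτ _ (fun _ => hv) (by fun_prop) (∑ i, 1 / ω i) fun q => ?_
  have h0 : 0 ≤ ∑ i, 1 / ω i := sum_nonneg fun i _ => (one_div_pos.2 (hω i)).le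
  have h1 : ψ (ratioStat ω q) ^ 2 ≤ 1 := by
    rw [← sq_abs]; exact pow_le_one₀ (abs_nonneg _) (hψ.abs_comp_ratioStat_le_one hω q)
  rw [abs_of_nonneg (mul_nonneg (diagQuad_nonneg hω _) (sq_nonneg _)), ← mul_assoc]
  calc diagQuad ω q.1 * ψ (ratioStat ω q) ^ 2 ≤ diagQuad ω q.1 :=
        mul_le_of_le_one_right (diagQuad_nonneg hω _) h1
    _ ≤ (∑ i, 1 / ω i) * polyEnvelope q.1 := diagQuad_le hω _
    _ ≤ (∑ i, 1 / ω i) * polyEnvelope q.1 ^ 2 := by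
        refine mul_le_mul_of_nonneg_left ?_ h0
        nlinarith [one_le_polyEnvelope q.1]
    _ ≤ _ := le_mul_polyEnvelope_sq (mul_nonneg h0 (sq_nonneg _)) _

lemma integrable_ratio_mul_sq (hψ : IsShrinkage ψ κ K) {p n : ℕ} {ω : Fin p → ℝ}
    (hω : ∀ i, 0 < ω i) (θ : Fin p → ℝ) {τ : Fin p → ℝ} (hτ : ∀ i, 0 < τ i) {v : ℝ} (hv : 0 < v) :
    Integrable fun q : (Fin p → ℝ) × (Fin n → ℝ) => ratioStat ω q * ψ (ratioStat ω q) ^ 2 *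
        (gaussKernel θ τ q.1 * gaussKernel (fun _ => 0) (fun _ => v) q.2) := by
  have hm := hψ.measurable
  refine integrable_mul_gaussKernel_prod θ hτ _ (fun _ => hv) (by fun_prop) κ fun q => ?_
  have hW := ratioStat_nonneg hω q
  have h1 := hψ.nonneg _ hW
  have h2 := hψ.le_one _ hW
  have h3 := hψ.mul_le _ hW
  have h4 := mul_nonneg hW h1
  rw [abs_of_nonneg (by positivity)]
  refine le_trans ?_ (le_mul_polyEnvelope_sq_mul (h4.trans h3) q)
  nlinarith

lemma integral_quad_mul_sq_le (hψ : IsShrinkage ψ κ K) {p n : ℕ} (hn : 0 < n) {ω : Fin p → ℝ}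
    (hω : ∀ i, 0 < ω i) (θ : Fin p → ℝ) {τ : Fin p → ℝ} (hτ : ∀ i, 0 < τ i) {v : ℝ} (hv : 0 < v) :
    ∫ q : (Fin p → ℝ) × (Fin n → ℝ), diagQuad ω q.1 * ψ (ratioStat ω q) ^ 2 *
        (gaussKernel θ τ q.1 * gaussKernel (fun _ => 0) (fun _ => v) q.2) ≤
      ((n : ℝ) + 2) * v * ∫ q : (Fin p → ℝ) × (Fin n → ℝ),
        ratioStat ω q * ψ (ratioStat ω q) ^ 2 *
          (gaussKernel θ τ q.1 * gaussKernel (fun _ => 0) (fun _ => v) q.2) := by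
  set s := ((n : ℝ) + 2) * v with hs
  have hs0 : 0 < s := by positivity
  have I1 := hψ.integrable_quad_mul_sq (n := n) hω θ hτ hv
  have I2 := hψ.integrable_ratio_mul_sq (n := n) hω θ hτ hv
  set g : (Fin n → ℝ) → ℝ := gaussKernel (fun _ => 0) (fun _ => v) with hg
  have hzero := integral_sumSq_mul_sub (n := n) hv
  rw [← hs, ← hg] at hzero
  have hm := hψ.measurable
  have J1 : Integrable fun x : Fin p → ℝ =>
      diagQuad ω x * ψ (diagQuad ω x / s) ^ 2 / s ^ 2 * gaussKernel θ τ x := by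
    refine integrable_mul_gaussKernel θ hτ (by fun_prop) ((∑ i, 1 / ω i) / s ^ 2) fun x => ?_
    have hW := div_nonneg (diagQuad_nonneg hω x) hs0.le
    have h1 : ψ (diagQuad ω x / s) ^ 2 ≤ 1 := pow_le_one₀ (hψ.nonneg _ hW) (hψ.le_one _ hW)
    have h0 : 0 ≤ ∑ i, 1 / ω i := sum_nonneg fun i _ => (one_div_pos.2 (hω i)).le
    have hQ := diagQuad_nonneg hω x
    rw [abs_of_nonneg (by positivity), div_mul_eq_mul_div]
    refine div_le_div_of_nonneg_right ?_ (by positivity)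
    calc diagQuad ω x * ψ (diagQuad ω x / s) ^ 2 ≤ diagQuad ω x := mul_le_of_le_one_right hQ h1
      _ ≤ (∑ i, 1 / ω i) * polyEnvelope x := diagQuad_le hω _
      _ ≤ (∑ i, 1 / ω i) * polyEnvelope x ^ 2 := by
          refine mul_le_mul_of_nonneg_left ?_ h0
          nlinarith [one_le_polyEnvelope x]
  have J2 : Integrable fun z : Fin n → ℝ => sumSq z * (sumSq z - s) * g z := by
    refine integrable_mul_gaussKernel _ (fun _ => hv) (by fun_prop) (1 + s) fun z => ?_
    have h1 := sum_sq_le_polyEnvelope z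
    have h2 := one_le_polyEnvelope z
    have h3 := sumSq_nonneg z
    change sumSq z ≤ _ at h1
    rw [abs_mul, abs_of_nonneg h3]
    have h4 : |sumSq z - s| ≤ (1 + s) * polyEnvelope z := by
      rw [abs_le]; constructor <;> nlinarith
    calc sumSq z * |sumSq z - s| ≤ polyEnvelope z * ((1 + s) * polyEnvelope z) := by gcongr
      _ = _ := by ring
  have J3 := J1.mul_prod J2
  have e0 := integral_prod_mul (μ := volume) (ν := volume) (fun x : Fin p → ℝ =>
      diagQuad ω x * ψ (diagQuad ω x / s) ^ 2 / s ^ 2 * gaussKernel θ τ x)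
      (fun z : Fin n → ℝ => sumSq z * (sumSq z - s) * g z)
  rw [hzero, mul_zero] at e0
  rw [← sub_nonpos, ← integral_const_mul, ← integral_sub I1 (I2.const_mul s), ← e0]
  refine integral_mono_ae (I1.sub (I2.const_mul s)) J3 ?_
  filter_upwards [ae_prod_sumSq_pos hn] with q hq
  have h := hψ.quad_mul_sq_sub_le hω hs0 hq
  have hpos : 0 < gaussKernel θ τ q.1 * g q.2 := mul_pos (gaussKernel_pos _ _ _) (gaussKernel_pos _ _ _)
  nlinarith [mul_le_mul_of_nonneg_right h hpos.le]

/-- The risk difference between the shrinkage estimator and the unshrunk one is nonpositive. -/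
theorem integral_risk_diff_nonpos (hψ : IsShrinkage ψ κ K) {p n : ℕ} (hn : 0 < n)
    {ω : Fin p → ℝ} (hω : ∀ i, 0 < ω i) (θ : Fin p → ℝ) {d : Fin p → ℝ} (hd : ∀ i, 0 < d i)
    {v : ℝ} (hv : 0 < v) {μ : Fin p → ℝ} {M : ℝ} (hμ : ∀ i, 0 ≤ μ i)
    (hM : ∀ i, μ i ≤ M) (hM0 : 0 ≤ M) (hκ : ((n : ℝ) + 2) * M * κ ≤ 2 * (∑ i, μ i - 2 * M)) :
    (Integrable fun q : (Fin p → ℝ) × (Fin n → ℝ) =>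
        (∑ i, (-2 * (μ i / d i) * ((q.1 i - θ i) * (ψ (ratioStat ω q) * q.1 i)))
          + ψ (ratioStat ω q) ^ 2 * ∑ i, μ i * (q.1 i ^ 2 / ω i)) *
          (gaussKernel θ (fun i => v * d i) q.1 * gaussKernel (fun _ => 0) (fun _ => v) q.2)) ∧
      ∫ q : (Fin p → ℝ) × (Fin n → ℝ),
        (∑ i, (-2 * (μ i / d i) * ((q.1 i - θ i) * (ψ (ratioStat ω q) * q.1 i)))
          + ψ (ratioStat ω q) ^ 2 * ∑ i, μ i * (q.1 i ^ 2 / ω i)) *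
          (gaussKernel θ (fun i => v * d i) q.1 * gaussKernel (fun _ => 0) (fun _ => v) q.2) ≤ 0 := by
  have hτ : ∀ i, 0 < v * d i := fun i => mul_pos hv (hd i)
  have hm := hψ.measurable
  have Ic := fun i => hψ.integrable_cross (n := n) hω θ hτ hv i
  have Id := fun i => hψ.integrable_divergence (n := n) hω θ hτ hv i
  have Iq := hψ.integrable_quad_mul_sq (n := n) hω θ hτ hv
  have Ir := hψ.integrable_ratio_mul_sq (n := n) hω θ hτ hv
  have Iψ := integrable_mul_gaussKernel_prod (n := n) θ hτ (fun _ => 0) (fun _ => hv)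
    (f := fun q => ψ (ratioStat ω q)) (by fun_prop) 1 fun q =>
      (hψ.abs_comp_ratioStat_le_one hω q).trans (le_mul_polyEnvelope_sq_mul zero_le_one q)
  have hcross := fun i => hψ.integral_cross (n := n) hω θ hτ hv i
  have b3 := hψ.integral_quad_mul_sq_le hn hω θ hτ hv
  obtain ⟨G, hG⟩ : ∃ G : (Fin p → ℝ) × (Fin n → ℝ) → ℝ, ∀ q, G q =
    gaussKernel θ (fun i => v * d i) q.1 * gaussKernel (fun _ => 0) (fun _ => v) q.2 :=
    ⟨_, fun _ => rfl⟩
  have hG0 : ∀ q, 0 < G q := fun q => by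
    rw [hG]; exact mul_pos (gaussKernel_pos _ _ _) (gaussKernel_pos _ _ _)
  have hGm : Measurable G := by rw [funext hG]; fun_prop
  simp only [← hG] at Ic Id Iq Ir Iψ hcross b3 ⊢
  have hξ : ∀ (q : (Fin p → ℝ) × (Fin n → ℝ)) i, 0 ≤ q.1 i ^ 2 / ω i :=
    fun q i => div_nonneg (sq_nonneg _) (hω i).le
  have hAM : ∀ q : (Fin p → ℝ) × (Fin n → ℝ),
      ∑ i, μ i * (q.1 i ^ 2 / ω i) ≤ M * diagQuad ω q.1 := fun q => by
    rw [diagQuad, mul_sum]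
    exact sum_le_sum fun i _ => mul_le_mul_of_nonneg_right (hM i) (hξ q i)
  have hA0 : ∀ q : (Fin p → ℝ) × (Fin n → ℝ), 0 ≤ ∑ i, μ i * (q.1 i ^ 2 / ω i) := fun q =>
    sum_nonneg fun i _ => mul_nonneg (hμ i) (hξ q i)
  have Iq' : Integrable fun q : (Fin p → ℝ) × (Fin n → ℝ) =>
      ψ (ratioStat ω q) ^ 2 * (∑ i, μ i * (q.1 i ^ 2 / ω i)) * G q := by
    refine (Iq.const_mul M).mono' (Measurable.aestronglyMeasurable (by fun_prop))
      (Filter.Eventually.of_forall fun q => ?_)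
    rw [Real.norm_of_nonneg (mul_nonneg (mul_nonneg (sq_nonneg _) (hA0 q)) (hG0 q).le), ← mul_assoc]
    refine mul_le_mul_of_nonneg_right ?_ (hG0 q).le
    nlinarith [hAM q, sq_nonneg (ψ (ratioStat ω q))]
  have e : ∀ q : (Fin p → ℝ) × (Fin n → ℝ),
      (∑ i, (-2 * (μ i / d i) * ((q.1 i - θ i) * (ψ (ratioStat ω q) * q.1 i)))
        + ψ (ratioStat ω q) ^ 2 * ∑ i, μ i * (q.1 i ^ 2 / ω i)) * G q =
      ∑ i, (-2 * (μ i / d i)) * ((q.1 i - θ i) * (ψ (ratioStat ω q) * q.1 i) * G q)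
        + ψ (ratioStat ω q) ^ 2 * (∑ i, μ i * (q.1 i ^ 2 / ω i)) * G q := fun q => by
    rw [add_mul, sum_mul]
    congr 1
    exact sum_congr rfl fun i _ => mul_assoc _ _ _
  have Ics : Integrable fun q : (Fin p → ℝ) × (Fin n → ℝ) =>
      ∑ i, (-2 * (μ i / d i)) * ((q.1 i - θ i) * (ψ (ratioStat ω q) * q.1 i) * G q) :=
    integrable_finsetSum _ fun i _ => (Ic i).const_mul _
  simp only [e]
  refine ⟨Ics.add Iq', ?_⟩
  rw [integral_add Ics Iq']
  have split : ∫ q : (Fin p → ℝ) × (Fin n → ℝ),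
      ∑ i, (-2 * (μ i / d i)) * ((q.1 i - θ i) * (ψ (ratioStat ω q) * q.1 i) * G q) =
      -2 * v * (∫ q, ∑ i, μ i * ((ψ (ratioStat ω q) +
        2 * (deriv ψ (ratioStat ω q) * (q.1 i ^ 2 / ω i / sumSq q.2))) * G q)) := by
    rw [integral_finsetSum _ fun i _ => (Id i).const_mul _, mul_sum,
      integral_finsetSum _ fun i _ => (Ic i).const_mul _]
    refine sum_congr rfl fun i _ => ?_
    rw [integral_const_mul, hcross i, integral_const_mul]
    have := (hd i).ne'
    field_simp
  have b1 : (∑ i, μ i - 2 * M) * ∫ q, ψ (ratioStat ω q) * G q ≤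
      ∫ q, ∑ i, μ i * ((ψ (ratioStat ω q) +
        2 * (deriv ψ (ratioStat ω q) * (q.1 i ^ 2 / ω i / sumSq q.2))) * G q) := by
    rw [← integral_const_mul]
    refine integral_mono_ae (Iψ.const_mul _)
      (integrable_finsetSum _ fun i _ => (Id i).const_mul _) ?_
    filter_upwards [ae_prod_sumSq_pos hn] with q hq
    have := mul_le_mul_of_nonneg_right (hψ.sum_divergence_ge hω hμ hM hM0 hq) (hG0 q).le
    simpa only [sum_mul, mul_assoc] using this
  have b2 : ∫ q, ψ (ratioStat ω q) ^ 2 * (∑ i, μ i * (q.1 i ^ 2 / ω i)) * G q ≤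
      M * ∫ q : (Fin p → ℝ) × (Fin n → ℝ), diagQuad ω q.1 * ψ (ratioStat ω q) ^ 2 * G q := by
    rw [← integral_const_mul]
    refine integral_mono Iq' (Iq.const_mul M) fun q => ?_
    change _ ≤ _ * (_ * G q)
    rw [← mul_assoc]
    refine mul_le_mul_of_nonneg_right ?_ (hG0 q).le
    nlinarith [hAM q, sq_nonneg (ψ (ratioStat ω q))]
  have b4 : ∫ q : (Fin p → ℝ) × (Fin n → ℝ), ratioStat ω q * ψ (ratioStat ω q) ^ 2 * G q ≤
      κ * ∫ q, ψ (ratioStat ω q) * G q := by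
    rw [← integral_const_mul]
    refine integral_mono Ir (Iψ.const_mul κ) fun q => ?_
    change _ ≤ _ * (_ * G q)
    rw [← mul_assoc]
    refine mul_le_mul_of_nonneg_right ?_ (hG0 q).le
    have hW := ratioStat_nonneg hω q
    nlinarith [hψ.mul_le _ hW, hψ.nonneg _ hW]
  have b0 : 0 ≤ ∫ q, ψ (ratioStat ω q) * G q :=
    integral_nonneg fun q => mul_nonneg (hψ.nonneg _ (ratioStat_nonneg hω q)) (hG0 q).le
  rw [split]
  generalize ∫ q, ψ (ratioStat ω q) * G q = E₀ at *
  calc _ ≤ -2 * v * ((∑ i, μ i - 2 * M) * E₀) + M * (((n : ℝ) + 2) * v * (κ * E₀)) := by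
        refine add_le_add (mul_le_mul_of_nonpos_left b1 (by linarith)) (b2.trans ?_)
        refine mul_le_mul_of_nonneg_left (b3.trans ?_) hM0
        exact mul_le_mul_of_nonneg_left b4 (by positivity)
    _ = v * E₀ * (((n : ℝ) + 2) * M * κ - 2 * (∑ i, μ i - 2 * M)) := by ring
    _ ≤ 0 := mul_nonpos_of_nonneg_of_nonpos (by positivity) (by linarith)

end IsShrinkage

@[fun_prop]
lemma measurable_gbIntegral (s b N : ℝ) : Measurable (gbIntegral s b N) := by
  unfold gbIntegral
  simp only [intervalIntegral.integral_of_le zero_le_one]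
  have h : Measurable (Function.uncurry fun v t : ℝ =>
      t ^ s * (1 - t) ^ b * (1 + v * t) ^ (-N)) := by
    unfold Function.uncurry
    fun_prop
  exact h.stronglyMeasurable.integral_prod_right.measurable

/-- The shrinkage factor of the generalized Bayes estimator satisfies the domination conditions. -/
lemma isShrinkage_gbRatio {α b N γ : ℝ} (hα : -1 < α) (hb : 0 ≤ b) (hN : 0 < N)
    (hN' : 0 < N - α - 2) (hγ : 1 ≤ γ) :
    IsShrinkage (fun w => gbRatio α b N (w / γ) / γ) ((α + 1) / (N - α - 2)) N := by
  have hγ0 : 0 < γ := by linarith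
  have hd : ∀ w, 0 ≤ w → HasDerivAt (fun w => gbRatio α b N (w / γ) / γ)
      (gbRatioDeriv α b N (w / γ) * (1 / γ) / γ) w := fun w hw => by
    have h1 : HasDerivAt (fun w : ℝ => w / γ) (1 / γ) w := (hasDerivAt_id w).div_const γ
    have h2 := hasDerivAt_gbRatio (v := w / γ) hα hb hN (div_nonneg hw hγ0.le)
    exact (h2.comp w h1).div_const γ
  have hm : ∀ w, w * (gbRatio α b N (w / γ) / γ) = w / γ * gbRatio α b N (w / γ) :=
    fun w => by ring
  have hneg : ∀ w, 0 ≤ w → -1 < w / γ := fun w hw => by linarith [div_nonneg hw hγ0.le]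
  refine ⟨?_, fun w hw => (hd w hw).differentiableAt, fun w hw => ?_, fun w hw => ?_,
    fun w hw => ?_, fun w₁ h₁ w₂ h₂ h => ?_, fun w hw => ?_⟩
  · unfold gbRatio
    fun_prop
  · exact div_nonneg (gbRatio_nonneg hα hb (hneg w hw) N) hγ0.le
  · rw [div_le_one hγ0]
    exact (gbRatio_lt_one hα hb (hneg w hw) N).le.trans hγ
  · rw [(hd w hw).deriv, show w * (gbRatioDeriv α b N (w / γ) * (1 / γ) / γ) =
      w / γ * gbRatioDeriv α b N (w / γ) / γ by ring, abs_div, abs_of_pos hγ0, div_le_iff₀ hγ0]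
    have := abs_mul_gbRatioDeriv_le hα hb hN (div_nonneg hw hγ0.le)
    nlinarith
  · simp only [hm]
    exact monotoneOn_mul_gbRatio hα hb (div_nonneg h₁ hγ0.le) (div_nonneg h₂ hγ0.le) (by gcongr)
  · rw [hm]
    exact mul_gbRatio_le hα hb hN' (div_nonneg hw hγ0.le)

lemma integrable_gaussKernel {m : ℕ} (θ : Fin m → ℝ) {τ : Fin m → ℝ} (hτ : ∀ i, 0 < τ i) :
    Integrable (gaussKernel θ τ) := by
  have h := integrable_mul_gaussKernel θ hτ (measurable_const (a := (1 : ℝ))) 1 fun x => by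
    rw [abs_one, one_mul]
    exact one_le_pow₀ (one_le_polyEnvelope x)
  simpa using h

lemma integrable_sub_sq_mul_gaussKernel {m : ℕ} (θ : Fin m → ℝ) {τ : Fin m → ℝ}
    (hτ : ∀ i, 0 < τ i) (i : Fin m) :
    Integrable fun x => (x i - θ i) ^ 2 * gaussKernel θ τ x := by
  refine integrable_mul_gaussKernel θ hτ (by fun_prop) (2 + 2 * θ i ^ 2) fun x => ?_
  rw [abs_of_nonneg (sq_nonneg _)]
  have h1 := one_add_sq_le_polyEnvelope x i
  have h2 : polyEnvelope x ≤ polyEnvelope x ^ 2 := by nlinarith [one_le_polyEnvelope x]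
  nlinarith [sq_nonneg (x i + θ i), mul_nonneg (sq_nonneg (θ i)) (sq_nonneg (x i)),
    mul_nonneg (sq_nonneg (θ i)) (sub_nonneg.2 (h1.trans h2))]

lemma integral_sub_sq_mul_gaussKernel {m : ℕ} (θ : Fin m → ℝ) {τ : Fin m → ℝ}
    (hτ : ∀ i, 0 < τ i) (i : Fin m) :
    ∫ x, (x i - θ i) ^ 2 * gaussKernel θ τ x = τ i * ∏ k, √(2 * Real.pi * τ k) := by
  have hI := integrable_sub_sq_mul_gaussKernel θ hτ i
  have hp : ∀ x : Fin m → ℝ, 1 ≤ polyEnvelope x ^ 2 := fun x =>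
    one_le_pow₀ (one_le_polyEnvelope x)
  have st := stein_identity θ hτ i (h := fun x => x i - θ i) (h' := fun _ => 1) ?_ ?_ ?_ ?_
  · simpa [sq, integral_gaussKernel] using st
  · intro x
    simpa using (hasDerivAt_id (x i)).sub_const (θ i)
  · refine integrable_mul_gaussKernel θ hτ (by fun_prop) (1 + |θ i|) fun x => ?_
    have h1 := one_add_sq_le_polyEnvelope x i
    have h2 : polyEnvelope x ≤ polyEnvelope x ^ 2 := by nlinarith [one_le_polyEnvelope x]
    have h3 : |x i| ≤ polyEnvelope x := by nlinarith [sq_abs (x i), sq_nonneg (|x i| - 1)]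
    have := abs_sub (x i) (θ i)
    nlinarith [abs_nonneg (θ i), hp x]
  · simpa only [sq] using hI
  · refine integrable_mul_gaussKernel θ hτ (by fun_prop) 1 fun x => ?_
    simpa using hp x

lemma gaussKernel_eq_exp {m : ℕ} (θ τ x : Fin m → ℝ) :
    gaussKernel θ τ x = Real.exp (∑ i, -(x i - θ i) ^ 2 / (2 * τ i)) :=
  (Real.exp_sum _ _).symm

lemma normalizing_const_mul {p n : ℕ} {d : Fin p → ℝ} (hd : ∀ i, 0 < d i) {v : ℝ} (hv : 0 < v) :
    (2 * Real.pi * v) ^ (-((p : ℝ) + n) / 2) * (∏ i, d i ^ (-(1 : ℝ) / 2)) *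
      ((∏ i, √(2 * Real.pi * (v * d i))) * ∏ _k : Fin n, √(2 * Real.pi * v)) = 1 := by
  have hr : 0 < 2 * Real.pi * v := by positivity
  have e1 : ∏ i, √(2 * Real.pi * (v * d i)) = √(2 * Real.pi * v) ^ p * ∏ i, √(d i) := by
    rw [← Fin.prod_const, ← prod_mul_distrib]
    exact prod_congr rfl fun i _ => by rw [← mul_assoc, Real.sqrt_mul hr.le]
  have e2 : (∏ i, d i ^ (-(1 : ℝ) / 2)) * ∏ i, √(d i) = 1 := by
    rw [← prod_mul_distrib]
    refine prod_eq_one fun i _ => ?_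
    rw [Real.sqrt_eq_rpow, ← Real.rpow_add (hd i)]
    norm_num
  have e3 : (2 * Real.pi * v) ^ (-((p : ℝ) + n) / 2) * √(2 * Real.pi * v) ^ (p + n) = 1 := by
    rw [Real.sqrt_eq_rpow, ← Real.rpow_natCast, ← Real.rpow_mul hr.le, ← Real.rpow_add hr]
    push_cast
    ring_nf
    exact Real.rpow_zero _
  rw [e1, Fin.prod_const]
  calc _ = ((2 * Real.pi * v) ^ (-((p : ℝ) + n) / 2) * √(2 * Real.pi * v) ^ (p + n)) *
        ((∏ i, d i ^ (-(1 : ℝ) / 2)) * ∏ i, √(d i)) := by rw [pow_add]; ring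
    _ = 1 := by rw [e2, e3, one_mul]

/-- Theorem 2.3: under normality (`X_i ~ N(θ_i, σ²d_i)` independent, `Z ~ N(0, σ²I_n)`),
the generalized Bayes estimator `θ̂_GB = (I − (φ_GB(W)/W) C^{-1}) X` (with
`W = XᵀC^{-1}D^{-1}X/S`, `S = ZᵀZ`) dominates `X` under the loss
`L_j(δ,θ,σ²) = (δ−θ)ᵀD^{-j}(δ−θ)/σ²` — whose risk for `X` is `∑ d_i^{1−j}` — provided
`b ≥ 0`, `e > −p/2 − n/2 − 2`, `−p/2 − 1 < a < n/2 + e`, and the `c_i ≥ 1` satisfy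
`0 ≤ (p/2+a+1)/(n/2+e−a) ≤ (2/(n+2)) ((∑ d_i^{1−j}/c_i)/(max_i d_i^{1−j}/c_i) − 2)`. -/
theorem stmt_7
    (p n : ℕ) (hp : 0 < p) (hn : 0 < n) (j : ℕ)
    (d c : Fin p → ℝ)
    (hd_pos : ∀ i, 0 < d i)
    (hd_mono : ∀ i k : Fin p, i ≤ k → d k ≤ d i)
    (hc : ∀ i, 1 ≤ c i)
    (a b e γ : ℝ) (hγ : 1 ≤ γ) (hb : 0 ≤ b)
    (he : -(p : ℝ) / 2 - (n : ℝ) / 2 - 2 < e)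
    (ha₁ : -(p : ℝ) / 2 - 1 < a) (ha₂ : a < (n : ℝ) / 2 + e)
    (hbound : 0 ≤ ((p : ℝ) / 2 + a + 1) / ((n : ℝ) / 2 + e - a) ∧
      ((p : ℝ) / 2 + a + 1) / ((n : ℝ) / 2 + e - a) ≤ 2 / ((n : ℝ) + 2) *
        ((∑ i, d i ^ ((1 : ℝ) - j) / c i) /
          (univ.sup' (univ_nonempty_iff.mpr (Fin.pos_iff_nonempty.mp hp))
            (fun i => d i ^ ((1 : ℝ) - j) / c i)) - 2))
    (φGB : ℝ → ℝ)
    (hφGB : ∀ w, φGB w =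
      (w * ∫ t in (0:ℝ)..1, t ^ ((p : ℝ) / 2 + a + 1) * (1 - t) ^ b *
        (1 + w * t / γ) ^ (-(p : ℝ) / 2 - (n : ℝ) / 2 - e - 2)) /
      (γ * ∫ t in (0:ℝ)..1, t ^ ((p : ℝ) / 2 + a) * (1 - t) ^ b *
        (1 + w * t / γ) ^ (-(p : ℝ) / 2 - (n : ℝ) / 2 - e - 2)))
    (θ : Fin p → ℝ) (σ : ℝ) (hσ : 0 < σ)
    -- the normal joint density of (X, Z)
    (dens : ((Fin p → ℝ) × (Fin n → ℝ)) → ℝ)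
    (hdens : dens = fun q => (2 * Real.pi * σ ^ 2) ^ (-((p : ℝ) + n) / 2) *
      (∏ i, (d i) ^ (-(1:ℝ)/2)) *
      Real.exp (-((∑ i, (q.1 i - θ i) ^ 2 / d i) + ∑ k, (q.2 k) ^ 2) / (2 * σ ^ 2)))
    (est : ((Fin p → ℝ) × (Fin n → ℝ)) → Fin p → ℝ)
    (hest : est = fun q i =>
      (1 - φGB ((∑ i', (q.1 i') ^ 2 / (c i' * d i')) / (∑ k, (q.2 k) ^ 2)) /
          ((∑ i', (q.1 i') ^ 2 / (c i' * d i')) / (∑ k, (q.2 k) ^ 2)) / c i) * q.1 i) :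
    (∫ q, (∑ i, (est q i - θ i) ^ 2 / d i ^ j) / σ ^ 2 * dens q ≤
        ∫ q, (∑ i, (q.1 i - θ i) ^ 2 / d i ^ j) / σ ^ 2 * dens q) ∧
      ∫ q, (∑ i, (q.1 i - θ i) ^ 2 / d i ^ j) / σ ^ 2 * dens q
        = ∑ i, d i ^ ((1 : ℝ) - j) := by
  have hσ2 : 0 < σ ^ 2 := by positivity
  have hc0 : ∀ i, 0 < c i := fun i => one_pos.trans_le (hc i)
  have hω : ∀ i, 0 < c i * d i := fun i => mul_pos (hc0 i) (hd_pos i)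
  have hτ : ∀ i, 0 < σ ^ 2 * d i := fun i => mul_pos hσ2 (hd_pos i)
  have hpow : ∀ i, d i ^ ((1 : ℝ) - j) = d i / d i ^ j := fun i => by
    rw [Real.rpow_sub (hd_pos i), Real.rpow_one, Real.rpow_natCast]
  have hψ := isShrinkage_gbRatio (α := (p : ℝ) / 2 + a) (b := b)
    (N := (p : ℝ) / 2 + (n : ℝ) / 2 + e + 2) (γ := γ)
    (by linarith) hb (by linarith) (by linarith) hγ
  obtain ⟨ψ, hψ_def⟩ : ∃ ψ : ℝ → ℝ, ∀ w, ψ w = gbRatio ((p : ℝ) / 2 + a) b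
    ((p : ℝ) / 2 + (n : ℝ) / 2 + e + 2) (w / γ) / γ := ⟨_, fun _ => rfl⟩
  rw [show (p : ℝ) / 2 + (n : ℝ) / 2 + e + 2 - ((p : ℝ) / 2 + a) - 2 = (n : ℝ) / 2 + e - a by ring,
    ← funext hψ_def] at hψ
  have hφ : ∀ w, w ≠ 0 → φGB w / w = ψ w := fun w hw => by
    have hexp : -(p : ℝ) / 2 - (n : ℝ) / 2 - e - 2 = -((p : ℝ) / 2 + (n : ℝ) / 2 + e + 2) := by ring
    simp only [hφGB, hψ_def, gbRatio, gbIntegral, hexp, mul_div_right_comm w]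
    rw [div_mul_eq_mul_div, div_right_comm, mul_div_cancel_left₀ _ hw, mul_comm γ, div_div]
  -- the weights of the shrinkage directions
  obtain ⟨μ, hμ_def⟩ : ∃ μ : Fin p → ℝ, ∀ i, μ i = d i ^ ((1 : ℝ) - j) / c i := ⟨_, fun _ => rfl⟩
  have hμ : ∀ i, 0 < μ i := fun i => by
    rw [hμ_def]; exact div_pos (Real.rpow_pos_of_pos (hd_pos i) _) (hc0 i)
  simp only [← hμ_def] at hbound
  have hM : ∀ i, μ i ≤ univ.sup' (univ_nonempty_iff.mpr (Fin.pos_iff_nonempty.mp hp))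
      fun i => μ i := fun i => le_sup' (fun i => μ i) (mem_univ i)
  generalize univ.sup' (univ_nonempty_iff.mpr (Fin.pos_iff_nonempty.mp hp))
    (fun i => μ i) = M at hbound hM
  have hM0 : 0 < M := (hμ ⟨0, hp⟩).trans_le (hM _)
  have hκ : ((n : ℝ) + 2) * M * (((p : ℝ) / 2 + a + 1) / ((n : ℝ) / 2 + e - a)) ≤
      2 * (∑ i, μ i - 2 * M) := by
    refine (mul_le_mul_of_nonneg_left hbound.2 (by positivity)).trans_eq ?_
    field_simp
  have hdiff := hψ.integral_risk_diff_nonpos hn hω θ hd_pos hσ2 (fun i => (hμ i).le) hM hM0.le hκ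
  obtain ⟨K₀, hK₀⟩ : ∃ K₀ : ℝ, K₀ = (2 * Real.pi * σ ^ 2) ^ (-((p : ℝ) + n) / 2) *
    ∏ i, d i ^ (-(1 : ℝ) / 2) := ⟨_, rfl⟩
  have hK₀0 : 0 ≤ K₀ := by
    rw [hK₀]
    exact mul_nonneg (by positivity) (prod_nonneg fun i _ => Real.rpow_nonneg (hd_pos i).le _)
  have hdensG : ∀ q, dens q = K₀ * (gaussKernel θ (fun i => σ ^ 2 * d i) q.1 *
      gaussKernel (fun _ => 0) (fun _ => σ ^ 2) q.2) := fun q => by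
    rw [hdens, hK₀, gaussKernel_eq_exp, gaussKernel_eq_exp, ← Real.exp_add]
    simp only [sub_zero]
    congr 2
    rw [neg_add, add_div, ← sum_neg_distrib, ← sum_neg_distrib, sum_div, sum_div]
    congr 1
    refine sum_congr rfl fun i _ => ?_
    have := (hd_pos i).ne'
    field_simp
  have hsq := fun i => (integrable_sub_sq_mul_gaussKernel θ hτ i).mul_prod
    (integrable_gaussKernel (fun _ : Fin n => (0 : ℝ)) fun _ => hσ2)
  have hX : ∀ q, (∑ i, (q.1 i - θ i) ^ 2 / d i ^ j) / σ ^ 2 * dens q =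
      ∑ i, K₀ / (d i ^ j * σ ^ 2) *
        ((q.1 i - θ i) ^ 2 * gaussKernel θ (fun i => σ ^ 2 * d i) q.1 *
          gaussKernel (fun _ => 0) (fun _ => σ ^ 2) q.2) := fun q => by
    rw [hdensG, sum_div, sum_mul]
    refine sum_congr rfl fun i _ => ?_
    have := (hd_pos i).ne'
    field_simp
  have hXint : Integrable fun q => (∑ i, (q.1 i - θ i) ^ 2 / d i ^ j) / σ ^ 2 * dens q := by
    simp only [hX]
    exact integrable_finsetSum _ fun i _ => (hsq i).const_mul _
  constructor
  · have key : ∀ᵐ q, (∑ i, (est q i - θ i) ^ 2 / d i ^ j) / σ ^ 2 * dens q =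
        (∑ i, (q.1 i - θ i) ^ 2 / d i ^ j) / σ ^ 2 * dens q + K₀ / σ ^ 2 *
        ((∑ i, (-2 * (μ i / d i) * ((q.1 i - θ i) *
            (ψ (ratioStat (fun i => c i * d i) q) * q.1 i)))
          + ψ (ratioStat (fun i => c i * d i) q) ^ 2 *
            ∑ i, μ i * (q.1 i ^ 2 / (c i * d i))) *
          (gaussKernel θ (fun i => σ ^ 2 * d i) q.1 *
            gaussKernel (fun _ => 0) (fun _ => σ ^ 2) q.2)) := by
      filter_upwards [ae_prod_sumSq_pos hn] with q hq
      have hestψ : ∀ i, est q i = (1 - ψ (ratioStat (fun i => c i * d i) q) / c i) * q.1 i := by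
        intro i
        rw [hest]
        change (1 - φGB (ratioStat (fun i => c i * d i) q) /
          ratioStat (fun i => c i * d i) q / c i) * q.1 i = _
        by_cases hW : ratioStat (fun i => c i * d i) q = 0
        · have hQ : diagQuad (fun i => c i * d i) q.1 = 0 :=
            (div_eq_zero_iff.1 hW).resolve_right hq.ne'
          have h0 : q.1 i ^ 2 / (c i * d i) = 0 :=
            le_antisymm (hQ ▸ sq_div_le_diagQuad hω q.1 i) (div_nonneg (sq_nonneg _) (hω i).le)
          rw [pow_eq_zero_iff two_ne_zero |>.1 ((div_eq_zero_iff.1 h0).resolve_right (hω i).ne')]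
          simp
        · rw [hφ _ hW]
      simp only [hestψ, hdensG q]
      generalize gaussKernel θ (fun i => σ ^ 2 * d i) q.1 *
        gaussKernel (fun _ => 0) (fun _ => σ ^ 2) q.2 = G
      generalize ψ (ratioStat (fun i => c i * d i) q) = y
      have hsum : ∑ i, ((1 - y / c i) * q.1 i - θ i) ^ 2 / d i ^ j =
          ∑ i, (q.1 i - θ i) ^ 2 / d i ^ j +
            (∑ i, (-2 * (μ i / d i) * ((q.1 i - θ i) * (y * q.1 i)))
              + y ^ 2 * ∑ i, μ i * (q.1 i ^ 2 / (c i * d i))) := by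
        rw [mul_sum, ← sum_add_distrib, ← sum_add_distrib]
        refine sum_congr rfl fun i _ => ?_
        rw [hμ_def, hpow]
        have h1 := (hd_pos i).ne'
        have h2 := (hc0 i).ne'
        field_simp
        ring
      rw [hsum]
      ring
    rw [integral_congr_ae key, integral_add hXint (hdiff.1.const_mul _), integral_const_mul]
    exact add_le_of_nonpos_right
      (mul_nonpos_of_nonneg_of_nonpos (div_nonneg hK₀0 hσ2.le) hdiff.2)
  · simp only [hX]
    rw [Measure.volume_eq_prod, integral_finsetSum _ fun i _ => (hsq i).const_mul _]
    refine sum_congr rfl fun i _ => ?_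
    rw [integral_const_mul, integral_prod_mul (fun x => (x i - θ i) ^ 2 * gaussKernel θ (fun i => σ ^ 2 * d i) x),
      integral_sub_sq_mul_gaussKernel θ hτ, integral_gaussKernel, hpow]
    have hnorm := normalizing_const_mul (n := n) hd_pos hσ2
    rw [← hK₀] at hnorm
    calc _ = d i / d i ^ j * (K₀ * ((∏ i, √(2 * Real.pi * (σ ^ 2 * d i))) *
          ∏ _k : Fin n, √(2 * Real.pi * σ ^ 2))) := by field_simp
      _ = d i / d i ^ j := by rw [hnorm, mul_one]
end

section
/- Suppose X ∈ ℝ^p and Z ∈ ℝ^n have joint density (∏_{i=1}^p d_i^{-1/2}) σ^{-p-n} f(((x−θ)ᵀD^{-1}(x−θ) + zᵀz)/σ²), set S = ZᵀZ and W = XᵀC^{-1}D^{-1}X/S, and define the simple estimator θ̂_SB = (I − (α/(γ(α+1) + W)) C^{-1}) X for constants α > 0 and γ ≥ 1. If 0 < α ≤ (2/(n+2)) ( (∑_{i=1}^p d_i^{1−j}/c_i)/(max_{1≤i≤p} d_i^{1−j}/c_i) − 2 ), and all expectations appearing in the risk computation are finite, then for every θ ∈ ℝ^p and σ² > 0 the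 risk satisfies R_j(θ̂_SB, θ, σ²) ≤ R_j(X, θ, σ²); i.e., θ̂_SB dominates the least squares estimator X (and hence is minimax) under the loss L_j. -/
open MeasureTheory Finset

/-- The upper tail integral `∫_u^∞ f`, with values in `[0, ∞]`. -/
noncomputable def upperTail (f : ℝ → ℝ) (u : ℝ) : ENNReal :=
  ∫⁻ v in Set.Ioi u, ENNReal.ofReal (f v)

lemma measurable_upperTail (f : ℝ → ℝ) : Measurable (upperTail f) := by
  have h : Antitone (upperTail f) := fun u v huv =>
    lintegral_mono_set (Set.Ioi_subset_Ioi huv)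
  exact h.measurable

lemma measurableSet_abs_lt (s : ℝ) : MeasurableSet {t : ℝ | |s| < |t|} :=
  measurableSet_lt measurable_const (by fun_prop)

lemma upperTail_eq_lintegral_Ioi (f : ℝ → ℝ) {a : ℝ} (ha : 0 < a) (r s : ℝ) :
    upperTail f (a * s ^ 2 + r) =
      ∫⁻ t in Set.Ioi |s|, ENNReal.ofReal (2 * a * |t|) * ENNReal.ofReal (f (a * t ^ 2 + r)) := by
  have hder : ∀ t ∈ Set.Ioi |s|,
      HasDerivWithinAt (fun t : ℝ => a * t ^ 2 + r) (2 * a * t) (Set.Ioi |s|) t := by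
    intro t _
    have := (((hasDerivAt_id t).pow 2).const_mul a).add_const r
    refine (this.congr_deriv ?_).hasDerivWithinAt
    simp; ring
  have hinj : Set.InjOn (fun t : ℝ => a * t ^ 2 + r) (Set.Ioi |s|) := by
    intro t ht u hu h
    have ht' : 0 ≤ t := (abs_nonneg s).trans (le_of_lt ht)
    have hu' : 0 ≤ u := (abs_nonneg s).trans (le_of_lt hu)
    have h2 : t ^ 2 = u ^ 2 := by
      have : a * t ^ 2 = a * u ^ 2 := by simpa using h
      exact mul_left_cancel₀ ha.ne' this
    exact (pow_left_inj₀ ht' hu' two_ne_zero).1 h2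
  have himg : (fun t : ℝ => a * t ^ 2 + r) '' Set.Ioi |s| = Set.Ioi (a * s ^ 2 + r) := by
    ext v
    constructor
    · rintro ⟨t, ht, rfl⟩
      have : s ^ 2 < t ^ 2 := by
        rw [← sq_abs s]
        exact pow_lt_pow_left₀ ht (abs_nonneg s) two_ne_zero
      simp only [Set.mem_Ioi]
      nlinarith
    · intro hv
      have hv' : s ^ 2 < (v - r) / a := by
        rw [lt_div_iff₀ ha]
        simp only [Set.mem_Ioi] at hv
        linarith
      refine ⟨√((v - r) / a), ?_, ?_⟩
      · rw [Set.mem_Ioi, ← Real.sqrt_sq_eq_abs]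
        exact Real.sqrt_lt_sqrt (sq_nonneg s) hv'
      · have : 0 ≤ (v - r) / a := (sq_nonneg s).trans hv'.le
        simp only [Real.sq_sqrt this]
        field_simp
        ring
  rw [upperTail, ← himg, lintegral_image_eq_lintegral_abs_deriv_mul measurableSet_Ioi hder hinj]
  simp [abs_mul, abs_of_pos ha]

lemma upperTail_eq_lintegral_abs {f : ℝ → ℝ} (hf : Measurable f) {a : ℝ} (ha : 0 < a)
    (r s : ℝ) :
    upperTail f (a * s ^ 2 + r) = ENNReal.ofReal a *
      ∫⁻ t in {t : ℝ | |s| < |t|}, ENNReal.ofReal (|t| * f (a * t ^ 2 + r)) := by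
  have hset : {t : ℝ | |s| < |t|} = Set.Ioi |s| ∪ (Set.Iio (-|s|)) := by
    ext t
    simp only [Set.mem_ofPred_eq, Set.mem_union, Set.mem_Ioi, Set.mem_Iio, lt_abs]
    exact or_congr_right lt_neg
  have hdisj : Disjoint (Set.Ioi |s|) (Set.Iio (-|s|)) := by
    rw [Set.disjoint_left]
    intro t h1 h2
    simp only [Set.mem_Ioi, Set.mem_Iio] at h1 h2
    linarith [abs_nonneg s]
  have hneg : ∫⁻ t in Set.Iio (-|s|), ENNReal.ofReal (|t| * f (a * t ^ 2 + r)) =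
      ∫⁻ t in Set.Ioi |s|, ENNReal.ofReal (|t| * f (a * t ^ 2 + r)) := by
    have := (Measure.measurePreserving_neg (volume : Measure ℝ)).setLIntegral_comp_preimage
      (s := Set.Iio (-|s|)) measurableSet_Iio
      (f := fun t => ENNReal.ofReal (|t| * f (a * t ^ 2 + r))) (by fun_prop)
    rw [← this]
    simp
  have hmain := upperTail_eq_lintegral_Ioi f ha r s
  have hcongr : ∀ t : ℝ, ENNReal.ofReal (2 * a * |t|) * ENNReal.ofReal (f (a * t ^ 2 + r)) =
      ENNReal.ofReal (2 * a) * ENNReal.ofReal (|t| * f (a * t ^ 2 + r)) := by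
    intro t
    rw [ENNReal.ofReal_mul (by positivity), ENNReal.ofReal_mul (abs_nonneg t), mul_assoc]
  simp_rw [hcongr] at hmain
  rw [lintegral_const_mul _ (by fun_prop)] at hmain
  rw [hset, lintegral_union measurableSet_Iio hdisj, hneg, hmain, ← two_mul, ← mul_assoc,
    mul_comm 2 a, ENNReal.ofReal_mul ha.le]
  simp

lemma measurableSet_abs_lt_abs : MeasurableSet {z : ℝ × ℝ | |z.1| < |z.2|} :=
  measurableSet_lt (by fun_prop) (by fun_prop)

lemma lintegral_upperTail {f : ℝ → ℝ} (hf : Measurable f) {a : ℝ} (ha : 0 < a) (r : ℝ) :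
    ∫⁻ s, upperTail f (a * s ^ 2 + r) =
      ENNReal.ofReal (2 * a) * ∫⁻ t : ℝ, ENNReal.ofReal (t ^ 2 * f (a * t ^ 2 + r)) := by
  have hmeas : Measurable (Function.uncurry fun s t : ℝ => {t : ℝ | |s| < |t|}.indicator
      (fun t => ENNReal.ofReal (|t| * f (a * t ^ 2 + r))) t) := by
    have : (Function.uncurry fun s t : ℝ => {t : ℝ | |s| < |t|}.indicator
        (fun t => ENNReal.ofReal (|t| * f (a * t ^ 2 + r))) t) =
        {z : ℝ × ℝ | |z.1| < |z.2|}.indicator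
          (fun z => ENNReal.ofReal (|z.2| * f (a * z.2 ^ 2 + r))) := by
      ext z
      simp [Set.indicator, Function.uncurry]
    rw [this]
    exact Measurable.indicator (by fun_prop) measurableSet_abs_lt_abs
  simp_rw [upperTail_eq_lintegral_abs hf ha, ← lintegral_indicator (measurableSet_abs_lt _)]
  rw [lintegral_const_mul _ hmeas.lintegral_prod_right, lintegral_lintegral_swap hmeas.aemeasurable,
    mul_comm 2 a, ENNReal.ofReal_mul ha.le, mul_assoc]
  congr 1
  rw [← lintegral_const_mul _ (by fun_prop)]
  refine lintegral_congr fun t => ?_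
  have hInd : ∀ s : ℝ, {t : ℝ | |s| < |t|}.indicator
      (fun t => ENNReal.ofReal (|t| * f (a * t ^ 2 + r))) t =
      (Set.Ioo (-|t|) |t|).indicator (fun _ => ENNReal.ofReal (|t| * f (a * t ^ 2 + r))) s := by
    intro s
    simp [Set.indicator, abs_lt]
  simp_rw [hInd]
  rw [lintegral_indicator measurableSet_Ioo, setLIntegral_const, Real.volume_Ioo,
    ENNReal.ofReal_mul (abs_nonneg t), ENNReal.ofReal_mul (sq_nonneg t), ← sq_abs t, sq,
    ENNReal.ofReal_mul (abs_nonneg t), show |t| - -|t| = 2 * |t| by ring,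
    ENNReal.ofReal_mul zero_le_two]
  ring

lemma integral_mul_eq_integral_deriv_mul_upperTail {f : ℝ → ℝ} (hf : Measurable f)
    (hf0 : ∀ t, 0 ≤ f t) {a : ℝ} (ha : 0 < a) (r : ℝ) {h h' : ℝ → ℝ} {K : ℝ}
    (hh : ∀ t, HasDerivAt h (h' t) t) (hm : Measurable h') (hK : ∀ t, |h' t| ≤ K)
    (hint : Integrable fun t : ℝ => t ^ 2 * f (a * t ^ 2 + r))
    (hint' : Integrable fun t : ℝ => t * h t * f (a * t ^ 2 + r)) :
    ∫ t : ℝ, t * h t * f (a * t ^ 2 + r) =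
      1 / (2 * a) * ∫ s, h' s * (upperTail f (a * s ^ 2 + r)).toReal := by
  have hsymm : ∫ t : ℝ, t * h t * f (a * t ^ 2 + r) =
      1 / 2 * ∫ t : ℝ, t * (h t - h (-t)) * f (a * t ^ 2 + r) := by
    have h1 := integral_neg_eq_self (fun t : ℝ => t * h t * f (a * t ^ 2 + r)) volume
    have h2 := hint'.comp_neg
    have h3 := integral_add hint' h2
    rw [h1] at h3
    have h4 : ∀ t : ℝ, t * h t * f (a * t ^ 2 + r) + -t * h (-t) * f (a * (-t) ^ 2 + r) =
        t * (h t - h (-t)) * f (a * t ^ 2 + r) := by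
      intro t
      rw [neg_sq]; ring
    simp_rw [h4] at h3
    rw [h3]; ring
  have hii : ∀ x y : ℝ, IntervalIntegrable h' volume x y := fun x y =>
    (intervalIntegrable_const (c := K)).mono_fun hm.aestronglyMeasurable
      (Filter.Eventually.of_forall fun t => (hK t).trans (le_abs_self K))
  let k : ℝ → ℝ → ℝ := fun s t =>
    {z : ℝ × ℝ | |z.1| < |z.2|}.indicator (fun z => h' z.1 * (|z.2| * f (a * z.2 ^ 2 + r))) (s, t)
  have hk1 : ∀ s t, k s t =
      (Set.Ioo (-|t|) |t|).indicator (fun s => h' s * (|t| * f (a * t ^ 2 + r))) s := by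
    intro s t
    simp [k, Set.indicator, abs_lt]
  have hk2 : ∀ s t, k s t =
      {t : ℝ | |s| < |t|}.indicator (fun t => h' s * (|t| * f (a * t ^ 2 + r))) t := by
    intro s t
    simp [k, Set.indicator]
  have hkm : Measurable (Function.uncurry k) :=
    Measurable.indicator (by fun_prop) measurableSet_abs_lt_abs
  have hki : Integrable (Function.uncurry k) (volume.prod volume) := by
    rw [integrable_prod_iff' hkm.aestronglyMeasurable]
    have hb : ∀ t : ℝ, IntegrableOn (fun s => h' s * (|t| * f (a * t ^ 2 + r)))
        (Set.Ioo (-|t|) |t|) := by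
      intro t
      have h0 : -|t| ≤ |t| := by linarith [abs_nonneg t]
      have := ((intervalIntegrable_iff_integrableOn_Ioo_of_le h0).1 (hii (-|t|) |t|))
      exact this.mul_const _
    constructor
    · refine Filter.Eventually.of_forall fun t => ?_
      simp only [Function.uncurry_apply_pair, hk1]
      exact (integrable_indicator_iff measurableSet_Ioo).2 (hb t)
    · refine (hint.const_mul (2 * K)).mono'
        hkm.stronglyMeasurable.norm.integral_prod_left'.aestronglyMeasurable
        (Filter.Eventually.of_forall fun t => ?_)
      rw [Real.norm_of_nonneg (integral_nonneg fun _ => norm_nonneg _)]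
      simp only [Function.uncurry_apply_pair, hk1, norm_indicator_eq_indicator_norm]
      rw [integral_indicator measurableSet_Ioo]
      have hc : ∀ s, ‖h' s * (|t| * f (a * t ^ 2 + r))‖ ≤ K * (|t| * f (a * t ^ 2 + r)) := by
        intro s
        rw [norm_mul, Real.norm_eq_abs,
          Real.norm_of_nonneg (mul_nonneg (abs_nonneg t) (hf0 _))]
        exact mul_le_mul_of_nonneg_right (hK s) (mul_nonneg (abs_nonneg t) (hf0 _))
      calc ∫ s in Set.Ioo (-|t|) |t|, ‖h' s * (|t| * f (a * t ^ 2 + r))‖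
          ≤ ∫ s in Set.Ioo (-|t|) |t|, K * (|t| * f (a * t ^ 2 + r)) :=
            integral_mono (hb t).norm (integrable_const _) hc
        _ = 2 * K * (t ^ 2 * f (a * t ^ 2 + r)) := by
            rw [setIntegral_const, Real.volume_real_Ioo_of_le (by linarith [abs_nonneg t]),
              ← sq_abs t, smul_eq_mul]
            ring
  have hleft : ∀ t : ℝ, t * (h t - h (-t)) * f (a * t ^ 2 + r) = ∫ s, k s t := by
    intro t
    simp_rw [hk1]
    have h0 : -|t| ≤ |t| := by linarith [abs_nonneg t]
    rw [integral_indicator measurableSet_Ioo, integral_mul_const,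
      ← integral_Ioc_eq_integral_Ioo, ← intervalIntegral.integral_of_le h0,
      intervalIntegral.integral_eq_sub_of_hasDerivAt (fun x _ => hh x) (hii _ _)]
    rcases abs_cases t with ⟨ht, _⟩ | ⟨ht, _⟩
    · rw [ht]; ring
    · rw [ht, neg_neg]; ring
  have hright : ∀ s : ℝ, ∫ t, k s t =
      1 / a * (h' s * (upperTail f (a * s ^ 2 + r)).toReal) := by
    intro s
    simp_rw [hk2]
    rw [integral_indicator (measurableSet_abs_lt s), integral_const_mul,
      integral_eq_lintegral_of_nonneg_ae
        (Filter.Eventually.of_forall fun t => mul_nonneg (abs_nonneg t) (hf0 _))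
        (by fun_prop), upperTail_eq_lintegral_abs hf ha, ENNReal.toReal_mul,
      ENNReal.toReal_ofReal ha.le]
    field_simp
  rw [hsymm]
  simp_rw [hleft]
  rw [← integral_integral_swap hki]
  simp_rw [hright]
  rw [integral_const_mul]
  field_simp

section Coordinate

variable {Ω E : Type*} [MeasurableSpace Ω] [MeasurableSpace E] {ν : Measure Ω} [SFinite ν]
  {μ : Measure E} {e : ℝ × Ω ≃ᵐ E} {f : ℝ → ℝ} {a : ℝ} {ρ : Ω → ℝ} {q y : E → ℝ}

lemma lintegral_upperTail_comp (he : MeasurePreserving e (volume.prod ν) μ)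
    (hf : Measurable f) (ha : 0 < a) (hq : Measurable q) (hy : Measurable y)
    (hqe : ∀ t ω, q (e (t, ω)) = a * t ^ 2 + ρ ω) (hye : ∀ t ω, y (e (t, ω)) = t) :
    ∫⁻ x, upperTail f (q x) ∂μ =
      ENNReal.ofReal (2 * a) * ∫⁻ x, ENNReal.ofReal (y x ^ 2 * f (q x)) ∂μ := by
  have h1 : Measurable fun x => upperTail f (q x) := (measurable_upperTail f).comp hq
  have h2 : Measurable fun x => ENNReal.ofReal (y x ^ 2 * f (q x)) := by fun_prop
  have h1e : Measurable fun x => upperTail f (q (e x)) := h1.comp e.measurable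
  have h2e : Measurable fun x => ENNReal.ofReal (y (e x) ^ 2 * f (q (e x))) :=
    h2.comp e.measurable
  rw [← he.lintegral_comp h1, ← he.lintegral_comp h2, lintegral_prod_symm' _ h1e,
    lintegral_prod_symm' _ h2e, ← lintegral_const_mul _ h2e.lintegral_prod_left']
  refine lintegral_congr fun ω => ?_
  simp_rw [hqe, hye]
  exact lintegral_upperTail hf ha _

lemma integral_coord_mul_eq (he : MeasurePreserving e (volume.prod ν) μ)
    (hf : Measurable f) (hf0 : ∀ t, 0 ≤ f t) (ha : 0 < a)
    (hqe : ∀ t ω, q (e (t, ω)) = a * t ^ 2 + ρ ω) (hye : ∀ t ω, y (e (t, ω)) = t)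
    {h h' : E → ℝ} {K : ℝ} (hm : Measurable h') (hK : ∀ x, |h' x| ≤ K)
    (hh : ∀ᵐ ω ∂ν, ∀ t, HasDerivAt (fun t => h (e (t, ω))) (h' (e (t, ω))) t)
    (hint : Integrable (fun x => y x ^ 2 * f (q x)) μ)
    (hint' : Integrable (fun x => y x * h x * f (q x)) μ)
    (htail : Integrable (fun x => (upperTail f (q x)).toReal) μ) :
    ∫ x, y x * h x * f (q x) ∂μ =
      1 / (2 * a) * ∫ x, h' x * (upperTail f (q x)).toReal ∂μ := by
  have hprod : Integrable (fun x => h' x * (upperTail f (q x)).toReal) μ :=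
    htail.bdd_mul hm.aestronglyMeasurable (Filter.Eventually.of_forall hK)
  have i1 := he.integrable_comp_of_integrable hint
  have i2 : Integrable (fun x => y (e x) * h (e x) * f (q (e x))) (volume.prod ν) :=
    he.integrable_comp_of_integrable hint'
  have i3 : Integrable (fun x => h' (e x) * (upperTail f (q (e x))).toReal) (volume.prod ν) :=
    he.integrable_comp_of_integrable hprod
  rw [← he.integral_comp' (fun x => y x * h x * f (q x)),
    ← he.integral_comp' (fun x => h' x * (upperTail f (q x)).toReal),
    integral_prod_symm _ i2, integral_prod_symm _ i3, ← integral_const_mul]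
  refine integral_congr_ae ?_
  filter_upwards [hh, i1.prod_left_ae, i2.prod_left_ae] with ω hω h1 h2
  simp only [Function.comp_apply, hqe, hye] at h1 h2 ⊢
  exact integral_mul_eq_integral_deriv_mul_upperTail hf hf0 ha _ hω
    (hm.comp (e.measurable.comp measurable_prodMk_right)) (fun t => hK _) h1 h2

end Coordinate

section Equivalences

variable {m : ℕ} {G : Type*} [MeasureSpace G]

/-- Singling out the coordinate `i`, recentred at `c`, of the first factor. -/
noncomputable def fstCoordEquiv (G : Type*) [MeasureSpace G] (i : Fin (m + 1)) (c : ℝ) :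
    ℝ × ((Fin m → ℝ) × G) ≃ᵐ (Fin (m + 1) → ℝ) × G :=
  MeasurableEquiv.prodAssoc.symm.trans
    ((((MeasurableEquiv.addRight c).prodCongr (MeasurableEquiv.refl _)).trans
      (MeasurableEquiv.piFinSuccAbove (fun _ => ℝ) i).symm).prodCongr (MeasurableEquiv.refl G))

lemma fstCoordEquiv_apply (i : Fin (m + 1)) (c t : ℝ) (x : Fin m → ℝ) (z : G) :
    fstCoordEquiv G i c (t, (x, z)) = (i.insertNth (t + c) x, z) := rfl

lemma measurePreserving_fstCoordEquiv [SFinite (volume : Measure G)] (i : Fin (m + 1)) (c : ℝ) :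
    MeasurePreserving (fstCoordEquiv G i c) (volume.prod volume) volume := by
  have h1 : MeasurePreserving (MeasurableEquiv.prodAssoc.symm : ℝ × ((Fin m → ℝ) × G) ≃ᵐ _)
      volume volume := volume_preserving_prodAssoc.symm _
  have h2 : MeasurePreserving (Prod.map (fun t : ℝ => t + c) (id : (Fin m → ℝ) → _))
      (volume.prod volume) (volume.prod volume) :=
    (measurePreserving_add_right volume c).prod (MeasurePreserving.id _)
  have h3 := (volume_preserving_piFinSuccAbove (fun _ : Fin (m + 1) => ℝ) i).symm
  exact ((h3.comp h2).prod (MeasurePreserving.id (volume : Measure G))).comp h1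

/-- Singling out the coordinate `i` of the second factor. -/
noncomputable def sndCoordEquiv (G : Type*) [MeasureSpace G] (i : Fin (m + 1)) :
    ℝ × ((Fin m → ℝ) × G) ≃ᵐ G × (Fin (m + 1) → ℝ) :=
  (fstCoordEquiv G i 0).trans MeasurableEquiv.prodComm

lemma sndCoordEquiv_apply (i : Fin (m + 1)) (t : ℝ) (x : Fin m → ℝ) (z : G) :
    sndCoordEquiv G i (t, (x, z)) = (z, i.insertNth t x) := by
  have : sndCoordEquiv G i (t, (x, z)) = (z, i.insertNth (t + 0) x) := rfl
  rw [this, add_zero]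

lemma measurePreserving_sndCoordEquiv [SFinite (volume : Measure G)] (i : Fin (m + 1)) :
    MeasurePreserving (sndCoordEquiv G i) (volume.prod volume) volume :=
  Measure.measurePreserving_swap.comp (measurePreserving_fstCoordEquiv i 0)

end Equivalences

/-- The diagonal quadratic form `∑ bᵢ xᵢ²`. -/
def diagForm {ι : Type*} [Fintype ι] (b x : ι → ℝ) : ℝ := ∑ i, b i * x i ^ 2

section DiagForm

variable {ι : Type*} [Fintype ι]

@[fun_prop]
lemma measurable_diagForm (b : ι → ℝ) : Measurable (diagForm b) := by
  unfold diagForm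
  fun_prop

lemma diagForm_nonneg {b : ι → ℝ} (hb : ∀ i, 0 ≤ b i) (x : ι → ℝ) : 0 ≤ diagForm b x :=
  Finset.sum_nonneg fun i _ => mul_nonneg (hb i) (sq_nonneg _)

lemma le_diagForm {b : ι → ℝ} (hb : ∀ i, 0 ≤ b i) (x : ι → ℝ) (i : ι) :
    b i * x i ^ 2 ≤ diagForm b x :=
  Finset.single_le_sum (f := fun i => b i * x i ^ 2)
    (fun i _ => mul_nonneg (hb i) (sq_nonneg _)) (Finset.mem_univ i)

lemma diagForm_pos {b : ι → ℝ} (hb : ∀ i, 0 < b i) {x : ι → ℝ} (hx : x ≠ 0) :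
    0 < diagForm b x := by
  obtain ⟨i, hi⟩ := Function.ne_iff.1 hx
  have hi' : x i ≠ 0 := hi
  exact (mul_pos (hb i) (by positivity)).trans_le (le_diagForm (fun i => (hb i).le) x i)

lemma ae_diagForm_pos [Nonempty ι] {b : ι → ℝ} (hb : ∀ i, 0 < b i) :
    ∀ᵐ x : ι → ℝ, 0 < diagForm b x := by
  have : ∀ᵐ x : ι → ℝ, x ≠ 0 := by
    simp [ae_iff]
  filter_upwards [this] with x hx using diagForm_pos hb hx

lemma diagForm_mul_le {b w : ι → ℝ} {M : ℝ} (hb : ∀ i, 0 ≤ b i) (hw : ∀ i, w i ≤ M)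
    (x : ι → ℝ) : diagForm (fun i => w i * b i) x ≤ M * diagForm b x := by
  unfold diagForm
  rw [Finset.mul_sum]
  refine Finset.sum_le_sum fun i _ => ?_
  rw [mul_assoc]
  exact mul_le_mul_of_nonneg_right (hw i) (mul_nonneg (hb i) (sq_nonneg _))

lemma diagForm_insertNth {m : ℕ} (b : Fin (m + 1) → ℝ) (i : Fin (m + 1)) (t : ℝ)
    (x : Fin m → ℝ) :
    diagForm b (i.insertNth t x) = b i * t ^ 2 + diagForm (fun k => b (i.succAbove k)) x := by
  simp [diagForm, Fin.sum_univ_succAbove _ i]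

lemma diagForm_insertNth_sub {m : ℕ} (b θ : Fin (m + 1) → ℝ) (i : Fin (m + 1)) (t : ℝ)
    (x : Fin m → ℝ) :
    diagForm b ((i.insertNth (t + θ i) x : Fin (m + 1) → ℝ) - θ) =
      b i * t ^ 2 + diagForm (fun k => b (i.succAbove k)) (x - fun k => θ (i.succAbove k)) := by
  simp [diagForm, Fin.sum_univ_succAbove _ i]

end DiagForm

section Scalar

variable {α g S B A M : ℝ}

lemma hasDerivAt_mul_shrinkage {b B₀ : ℝ} (hg : 0 < g) (hS : 0 < S) (hb : 0 ≤ b) (hB : 0 ≤ B₀)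
    (θ t : ℝ) :
    HasDerivAt (fun t => (t + θ) * (α * S / (g * S + (b * (t + θ) ^ 2 + B₀))))
      (α * S / (g * S + (b * (t + θ) ^ 2 + B₀)) *
        (1 - 2 * (b * (t + θ) ^ 2) / (g * S + (b * (t + θ) ^ 2 + B₀)))) t := by
  have hQ : g * S + (b * (t + θ) ^ 2 + B₀) ≠ 0 := by positivity
  have h1 : HasDerivAt (fun t => t + θ) 1 t := (hasDerivAt_id t).add_const θ
  have h2 := ((((h1.pow 2).const_mul b).add_const B₀).const_add (g * S))
  have h3 := h1.mul ((hasDerivAt_const t (α * S)).div h2 hQ)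
  refine h3.congr_deriv ?_
  simp only [Pi.pow_apply, Pi.div_apply]
  field_simp
  push_cast
  ring

lemma hasDerivAt_mul_sq_shrinkage {S₀ : ℝ} (hg : 0 < g) (hS : 0 ≤ S₀) (hB : 0 < B) (t : ℝ) :
    HasDerivAt (fun t => t * (A * (α ^ 2 * (t ^ 2 + S₀) / (g * (t ^ 2 + S₀) + B) ^ 2)))
      (A * (α ^ 2 * (t ^ 2 + S₀) / (g * (t ^ 2 + S₀) + B) ^ 2) +
        2 * t ^ 2 * A * (α ^ 2 * (B - g * (t ^ 2 + S₀)) / (g * (t ^ 2 + S₀) + B) ^ 3)) t := by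
  have hQ : g * (t ^ 2 + S₀) + B ≠ 0 := by positivity
  have h1 := (((hasDerivAt_id t).pow 2).add_const S₀)
  have h2 := ((h1.const_mul g).add_const B).pow 2
  have h3 := (hasDerivAt_id t).mul (((h1.const_mul (α ^ 2)).div h2 (pow_ne_zero 2 hQ)).const_mul A)
  refine h3.congr_deriv ?_
  simp only [Pi.pow_apply, Pi.div_apply, id]
  field_simp
  push_cast
  ring

lemma div_add_le_inv (hg : 0 < g) (hS : 0 ≤ S) (hB : 0 ≤ B) : S / (g * S + B) ≤ 1 / g := by
  rcases hS.eq_or_lt with rfl | hS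
  · simp [hg.le]
  · rw [div_le_div_iff₀ (by positivity) hg]
    linarith

lemma div_add_le_of_le_mul (hg : 0 < g) (hS : 0 ≤ S) (hB : 0 ≤ B) (hM : 0 ≤ M)
    (hA : A ≤ M * B) : A / (g * S + B) ≤ M := by
  refine div_le_of_le_mul₀ (by positivity) hM (hA.trans ?_)
  exact mul_le_mul_of_nonneg_left (by nlinarith) hM

lemma abs_sub_div_add_le_one (hg : 0 < g) (hS : 0 ≤ S) (hB : 0 ≤ B) :
    |(B - g * S) / (g * S + B)| ≤ 1 := by
  have h : 0 ≤ g * S := by positivity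
  rw [abs_div, abs_of_nonneg (add_nonneg h hB)]
  refine div_le_one_of_le₀ ?_ (by positivity)
  rw [abs_le]
  constructor <;> linarith

lemma abs_deriv_shrinkage_le {u : ℝ} (hα : 0 < α) (hg : 0 < g) (hS : 0 ≤ S) (hu : 0 ≤ u)
    (huB : u ≤ B) :
    |α * S / (g * S + B) * (1 - 2 * u / (g * S + B))| ≤ 3 * α / g := by
  have hB := hu.trans huB
  have h1 := div_add_le_inv hg hS hB
  have h2 : u / (g * S + B) ≤ 1 :=
    div_add_le_of_le_mul hg hS hB zero_le_one (by linarith)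
  have h3 : 0 ≤ u / (g * S + B) := by positivity
  have h4 : 0 ≤ S / (g * S + B) := by positivity
  rw [mul_div_assoc, mul_div_assoc 2, abs_mul, abs_of_nonneg (mul_nonneg hα.le h4)]
  calc α * (S / (g * S + B)) * |1 - 2 * (u / (g * S + B))| ≤ α * (1 / g) * 3 := by
        gcongr
        rw [abs_le]
        constructor <;> linarith
    _ = 3 * α / g := by ring

lemma sq_shrinkage_nonneg_le (hg : 0 < g) (hS : 0 ≤ S) (hB : 0 ≤ B)
    (hM : 0 ≤ M) (hA : 0 ≤ A) (hAB : A ≤ M * B) :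
    0 ≤ A * (α ^ 2 * S / (g * S + B) ^ 2) ∧
      A * (α ^ 2 * S / (g * S + B) ^ 2) ≤ M * α ^ 2 / g := by
  refine ⟨by positivity, ?_⟩
  have h1 := div_add_le_inv hg hS hB
  have h2 := div_add_le_of_le_mul hg hS hB hM hAB
  calc A * (α ^ 2 * S / (g * S + B) ^ 2)
      = (A / (g * S + B)) * (α ^ 2 * (S / (g * S + B))) := by
        rw [sq (g * S + B)]; simp only [div_eq_mul_inv, mul_inv]; ring
    _ ≤ M * (α ^ 2 * (1 / g)) := by gcongr
    _ = M * α ^ 2 / g := by ring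

lemma abs_deriv_sq_shrinkage_le {ζ : ℝ} (hg : 0 < g) (hB : 0 ≤ B)
    (hM : 0 ≤ M) (hA : 0 ≤ A) (hAB : A ≤ M * B) (hζ : 0 ≤ ζ) (hζS : ζ ≤ S) :
    |A * (α ^ 2 * S / (g * S + B) ^ 2) +
        2 * ζ * A * (α ^ 2 * (B - g * S) / (g * S + B) ^ 3)| ≤ 3 * (M * α ^ 2 / g) := by
  have hS := hζ.trans hζS
  obtain ⟨h1, h2⟩ := sq_shrinkage_nonneg_le (α := α) hg hS hB hM hA hAB
  have h3 : |2 * ζ * A * (α ^ 2 * (B - g * S) / (g * S + B) ^ 3)| ≤ 2 * (M * α ^ 2 / g) := by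
    have h4 := abs_sub_div_add_le_one hg hS hB
    have h5 : 2 * ζ * A * (α ^ 2 * (B - g * S) / (g * S + B) ^ 3) =
        2 * (A * (α ^ 2 * ζ / (g * S + B) ^ 2)) * ((B - g * S) / (g * S + B)) := by
      rw [pow_succ (g * S + B) 2]; simp only [div_eq_mul_inv, mul_inv]; ring
    have h6 : A * (α ^ 2 * ζ / (g * S + B) ^ 2) ≤ M * α ^ 2 / g := h2.trans' (by gcongr)
    have h7 : 0 ≤ A * (α ^ 2 * ζ / (g * S + B) ^ 2) := by positivity
    rw [h5, abs_mul, abs_of_nonneg (by positivity)]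
    calc _ ≤ 2 * (M * α ^ 2 / g) * 1 := by gcongr
      _ = _ := mul_one _
  refine (abs_add_le _ _).trans ?_
  rw [abs_of_nonneg h1]
  linarith

lemma shrinkage_divergence_nonpos {N V : ℝ} (hα : 0 < α) (hg : 0 < g) (hS : 0 ≤ S) (hB : 0 ≤ B)
    (hM : 0 ≤ M) (hA : 0 ≤ A) (hAB : A ≤ M * B) (hN : 0 ≤ N)
    (hV : M * (4 + α * (N + 2)) ≤ 2 * V) :
    -2 * (α * S / (g * S + B) * (V - 2 * A / (g * S + B))) +
      (N * (A * (α ^ 2 * S / (g * S + B) ^ 2)) +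
        2 * S * A * (α ^ 2 * (B - g * S) / (g * S + B) ^ 3)) ≤ 0 := by
  have h1 := div_add_le_of_le_mul hg hS hB hM hAB
  have h2 := (abs_le.1 (abs_sub_div_add_le_one hg hS hB)).2
  have h3 : 0 ≤ A / (g * S + B) := by positivity
  have h4 : 0 ≤ S / (g * S + B) := by positivity
  have h5 : -2 * (α * S / (g * S + B) * (V - 2 * A / (g * S + B))) +
      (N * (A * (α ^ 2 * S / (g * S + B) ^ 2)) +
        2 * S * A * (α ^ 2 * (B - g * S) / (g * S + B) ^ 3)) =
      α * (S / (g * S + B)) * ((A / (g * S + B)) *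
        (4 + α * (N + 2 * ((B - g * S) / (g * S + B)))) - 2 * V) := by
    rw [pow_succ (g * S + B) 2, sq (g * S + B)]
    simp only [div_eq_mul_inv, mul_inv]
    ring
  rw [h5]
  refine mul_nonpos_of_nonneg_of_nonpos (by positivity) ?_
  have h6 : (A / (g * S + B)) * (4 + α * (N + 2 * ((B - g * S) / (g * S + B)))) ≤
      (A / (g * S + B)) * (4 + α * (N + 2)) := by
    gcongr
    linarith
  have h7 : (A / (g * S + B)) * (4 + α * (N + 2)) ≤ M * (4 + α * (N + 2)) := by
    gcongr
  linarith

end Scalar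

section Risk

variable {m n : ℕ} {b w β θ : Fin (m + 1) → ℝ} {α g τ M : ℝ} {f : ℝ → ℝ}

lemma lintegral_upperTail_fst (hf : Measurable f) (hβ : ∀ i, 0 < β i) (i : Fin (m + 1)) :
    ∫⁻ x : (Fin (m + 1) → ℝ) × (Fin n → ℝ),
        upperTail f (diagForm β (x.1 - θ) + diagForm (fun _ => τ) x.2) =
      ENNReal.ofReal (2 * β i) * ∫⁻ x : (Fin (m + 1) → ℝ) × (Fin n → ℝ),
        ENNReal.ofReal ((x.1 i - θ i) ^ 2 *
          f (diagForm β (x.1 - θ) + diagForm (fun _ => τ) x.2)) := by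
  refine lintegral_upperTail_comp (e := fstCoordEquiv (Fin n → ℝ) i (θ i))
    (ρ := fun ω => diagForm (fun k => β (i.succAbove k)) (ω.1 - fun k => θ (i.succAbove k)) +
      diagForm (fun _ => τ) ω.2)
    (y := fun x : (Fin (m + 1) → ℝ) × (Fin n → ℝ) => x.1 i - θ i)
    (measurePreserving_fstCoordEquiv i (θ i)) hf (hβ i) (by fun_prop) (by fun_prop) ?_ ?_
  · rintro t ⟨x, z⟩
    simp only [fstCoordEquiv_apply, diagForm_insertNth_sub]
    ring
  · rintro t ⟨x, z⟩
    simp [fstCoordEquiv_apply]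

lemma lintegral_upperTail_snd (hf : Measurable f) (hτ : 0 < τ) (k : Fin (n + 1)) :
    ∫⁻ x : (Fin (m + 1) → ℝ) × (Fin (n + 1) → ℝ),
        upperTail f (diagForm β (x.1 - θ) + diagForm (fun _ => τ) x.2) =
      ENNReal.ofReal (2 * τ) * ∫⁻ x : (Fin (m + 1) → ℝ) × (Fin (n + 1) → ℝ),
        ENNReal.ofReal ((x.2 k) ^ 2 *
          f (diagForm β (x.1 - θ) + diagForm (fun _ => τ) x.2)) := by
  refine lintegral_upperTail_comp (e := sndCoordEquiv (Fin (m + 1) → ℝ) k)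
    (ρ := fun ω => diagForm (fun _ => τ) ω.1 + diagForm β (ω.2 - θ))
    (y := fun x : (Fin (m + 1) → ℝ) × (Fin (n + 1) → ℝ) => x.2 k)
    (measurePreserving_sndCoordEquiv k) hf hτ (by fun_prop) (by fun_prop) ?_ ?_
  · rintro t ⟨x, z⟩
    simp only [sndCoordEquiv_apply, diagForm_insertNth]
    ring
  · rintro t ⟨x, z⟩
    simp [sndCoordEquiv_apply]

lemma integral_fst_shrinkage (hf : Measurable f) (hf0 : ∀ t, 0 ≤ f t) (hb : ∀ i, 0 < b i)
    (hβ : ∀ i, 0 < β i) (hα : 0 < α) (hg : 0 < g) (i : Fin (m + 1))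
    (hint0 : Integrable fun x : (Fin (m + 1) → ℝ) × (Fin (n + 1) → ℝ) =>
      f (diagForm β (x.1 - θ) + diagForm (fun _ => τ) x.2))
    (hint : Integrable fun x : (Fin (m + 1) → ℝ) × (Fin (n + 1) → ℝ) => (x.1 i - θ i) ^ 2 *
      f (diagForm β (x.1 - θ) + diagForm (fun _ => τ) x.2))
    (htail : Integrable fun x : (Fin (m + 1) → ℝ) × (Fin (n + 1) → ℝ) =>
      (upperTail f (diagForm β (x.1 - θ) + diagForm (fun _ => τ) x.2)).toReal) :
    (Integrable fun x : (Fin (m + 1) → ℝ) × (Fin (n + 1) → ℝ) => (x.1 i - θ i) *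
      (x.1 i * (α * diagForm (fun _ => 1) x.2 /
        (g * diagForm (fun _ => 1) x.2 + diagForm b x.1))) *
        f (diagForm β (x.1 - θ) + diagForm (fun _ => τ) x.2)) ∧
    (Integrable fun x : (Fin (m + 1) → ℝ) × (Fin (n + 1) → ℝ) =>
      (α * diagForm (fun _ => 1) x.2 / (g * diagForm (fun _ => 1) x.2 + diagForm b x.1) *
        (1 - 2 * (b i * x.1 i ^ 2) / (g * diagForm (fun _ => 1) x.2 + diagForm b x.1))) *
        (upperTail f (diagForm β (x.1 - θ) + diagForm (fun _ => τ) x.2)).toReal) ∧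
    ∫ x : (Fin (m + 1) → ℝ) × (Fin (n + 1) → ℝ), (x.1 i - θ i) *
      (x.1 i * (α * diagForm (fun _ => 1) x.2 /
        (g * diagForm (fun _ => 1) x.2 + diagForm b x.1))) *
        f (diagForm β (x.1 - θ) + diagForm (fun _ => τ) x.2) =
    1 / (2 * β i) * ∫ x : (Fin (m + 1) → ℝ) × (Fin (n + 1) → ℝ),
      (α * diagForm (fun _ => 1) x.2 / (g * diagForm (fun _ => 1) x.2 + diagForm b x.1) *
        (1 - 2 * (b i * x.1 i ^ 2) / (g * diagForm (fun _ => 1) x.2 + diagForm b x.1))) *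
        (upperTail f (diagForm β (x.1 - θ) + diagForm (fun _ => τ) x.2)).toReal := by
  have hS : ∀ z : Fin (n + 1) → ℝ, 0 ≤ diagForm (fun _ => 1) z :=
    diagForm_nonneg fun _ => zero_le_one
  have hB : ∀ x, 0 ≤ diagForm b x := diagForm_nonneg fun i => (hb i).le
  have hK : ∀ x : (Fin (m + 1) → ℝ) × (Fin (n + 1) → ℝ),
      |α * diagForm (fun _ => 1) x.2 / (g * diagForm (fun _ => 1) x.2 + diagForm b x.1) *
        (1 - 2 * (b i * x.1 i ^ 2) / (g * diagForm (fun _ => 1) x.2 + diagForm b x.1))|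
        ≤ 3 * α / g := fun x =>
    abs_deriv_shrinkage_le hα hg (hS _) (mul_nonneg (hb i).le (sq_nonneg _))
      (le_diagForm (fun i => (hb i).le) _ i)
  have hint' : Integrable fun x : (Fin (m + 1) → ℝ) × (Fin (n + 1) → ℝ) => (x.1 i - θ i) *
      (x.1 i * (α * diagForm (fun _ => 1) x.2 /
        (g * diagForm (fun _ => 1) x.2 + diagForm b x.1))) *
        f (diagForm β (x.1 - θ) + diagForm (fun _ => τ) x.2) := by
    refine ((hint.const_mul (2 * (α / g))).add (hint0.const_mul (α / g * θ i ^ 2))).mono'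
      (Measurable.aestronglyMeasurable (by fun_prop)) (Filter.Eventually.of_forall fun x => ?_)
    have h1 := div_add_le_inv hg (hS x.2) (hB x.1)
    have h2 : 0 ≤ diagForm (fun _ => 1) x.2 / (g * diagForm (fun _ => 1) x.2 + diagForm b x.1) :=
      div_nonneg (hS _) (add_nonneg (mul_nonneg hg.le (hS _)) (hB _))
    have h3 : |(x.1 i - θ i) * x.1 i| ≤ 2 * (x.1 i - θ i) ^ 2 + θ i ^ 2 := by
      rw [abs_le]
      constructor <;> nlinarith [sq_nonneg (x.1 i - θ i + θ i), sq_nonneg (x.1 i - θ i - θ i)]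
    rw [Real.norm_eq_abs, abs_mul, abs_of_nonneg (hf0 _), ← mul_assoc, abs_mul, mul_div_assoc,
      abs_of_nonneg (mul_nonneg hα.le h2)]
    simp only [Pi.add_apply]
    calc _ ≤ (2 * (x.1 i - θ i) ^ 2 + θ i ^ 2) * (α * (1 / g)) *
          f (diagForm β (x.1 - θ) + diagForm (fun _ => τ) x.2) := by
          gcongr
          exact hf0 _
      _ = _ := by ring
  refine ⟨hint', htail.bdd_mul (Measurable.aestronglyMeasurable (by fun_prop))
    (Filter.Eventually.of_forall hK), ?_⟩
  refine integral_coord_mul_eq (e := fstCoordEquiv (Fin (n + 1) → ℝ) i (θ i))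
    (ρ := fun ω => diagForm (fun k => β (i.succAbove k)) (ω.1 - fun k => θ (i.succAbove k)) +
      diagForm (fun _ => τ) ω.2)
    (y := fun x : (Fin (m + 1) → ℝ) × (Fin (n + 1) → ℝ) => x.1 i - θ i)
    (measurePreserving_fstCoordEquiv i (θ i)) hf hf0 (hβ i) ?_ ?_ (by fun_prop) hK ?_
    hint hint' htail
  · rintro t ⟨x, z⟩
    simp only [fstCoordEquiv_apply, diagForm_insertNth_sub]
    ring
  · rintro t ⟨x, z⟩
    simp [fstCoordEquiv_apply]
  · have hae : ∀ᵐ ω : (Fin m → ℝ) × (Fin (n + 1) → ℝ), 0 < diagForm (fun _ => 1) ω.2 :=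
      Measure.quasiMeasurePreserving_snd.ae (ae_diagForm_pos fun _ => one_pos)
    filter_upwards [hae] with ω hω t
    obtain ⟨x, z⟩ := ω
    simp only [fstCoordEquiv_apply, diagForm_insertNth, Fin.insertNth_apply_same]
    exact hasDerivAt_mul_shrinkage hg hω (hb i).le (diagForm_nonneg (fun k => (hb _).le) x) _ t

lemma integral_snd_shrinkage (hf : Measurable f) (hf0 : ∀ t, 0 ≤ f t) (hb : ∀ i, 0 < b i)
    (hw : ∀ i, 0 ≤ w i) (hwM : ∀ i, w i ≤ M)
    (hτ : 0 < τ) (hg : 0 < g) (k : Fin (n + 1))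
    (hint : Integrable fun x : (Fin (m + 1) → ℝ) × (Fin (n + 1) → ℝ) => (x.2 k) ^ 2 *
      f (diagForm β (x.1 - θ) + diagForm (fun _ => τ) x.2))
    (htail : Integrable fun x : (Fin (m + 1) → ℝ) × (Fin (n + 1) → ℝ) =>
      (upperTail f (diagForm β (x.1 - θ) + diagForm (fun _ => τ) x.2)).toReal) :
    (Integrable fun x : (Fin (m + 1) → ℝ) × (Fin (n + 1) → ℝ) => x.2 k *
      (x.2 k * (diagForm (fun i => w i * b i) x.1 * (α ^ 2 * diagForm (fun _ => 1) x.2 /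
        (g * diagForm (fun _ => 1) x.2 + diagForm b x.1) ^ 2))) *
        f (diagForm β (x.1 - θ) + diagForm (fun _ => τ) x.2)) ∧
    (Integrable fun x : (Fin (m + 1) → ℝ) × (Fin (n + 1) → ℝ) =>
      (diagForm (fun i => w i * b i) x.1 * (α ^ 2 * diagForm (fun _ => 1) x.2 /
        (g * diagForm (fun _ => 1) x.2 + diagForm b x.1) ^ 2) +
        2 * x.2 k ^ 2 * diagForm (fun i => w i * b i) x.1 *
          (α ^ 2 * (diagForm b x.1 - g * diagForm (fun _ => 1) x.2) /
            (g * diagForm (fun _ => 1) x.2 + diagForm b x.1) ^ 3)) *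
        (upperTail f (diagForm β (x.1 - θ) + diagForm (fun _ => τ) x.2)).toReal) ∧
    ∫ x : (Fin (m + 1) → ℝ) × (Fin (n + 1) → ℝ), x.2 k *
      (x.2 k * (diagForm (fun i => w i * b i) x.1 * (α ^ 2 * diagForm (fun _ => 1) x.2 /
        (g * diagForm (fun _ => 1) x.2 + diagForm b x.1) ^ 2))) *
        f (diagForm β (x.1 - θ) + diagForm (fun _ => τ) x.2) =
    1 / (2 * τ) * ∫ x : (Fin (m + 1) → ℝ) × (Fin (n + 1) → ℝ),
      (diagForm (fun i => w i * b i) x.1 * (α ^ 2 * diagForm (fun _ => 1) x.2 /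
        (g * diagForm (fun _ => 1) x.2 + diagForm b x.1) ^ 2) +
        2 * x.2 k ^ 2 * diagForm (fun i => w i * b i) x.1 *
          (α ^ 2 * (diagForm b x.1 - g * diagForm (fun _ => 1) x.2) /
            (g * diagForm (fun _ => 1) x.2 + diagForm b x.1) ^ 3)) *
        (upperTail f (diagForm β (x.1 - θ) + diagForm (fun _ => τ) x.2)).toReal := by
  have hM : 0 ≤ M := (hw 0).trans (hwM 0)
  have hS : ∀ z : Fin (n + 1) → ℝ, 0 ≤ diagForm (fun _ => 1) z :=
    diagForm_nonneg fun _ => zero_le_one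
  have hB : ∀ x, 0 ≤ diagForm b x := diagForm_nonneg fun i => (hb i).le
  have hA : ∀ x, 0 ≤ diagForm (fun i => w i * b i) x :=
    diagForm_nonneg fun i => mul_nonneg (hw i) (hb i).le
  have hAB : ∀ x, diagForm (fun i => w i * b i) x ≤ M * diagForm b x :=
    diagForm_mul_le (fun i => (hb i).le) hwM
  have hK : ∀ x : (Fin (m + 1) → ℝ) × (Fin (n + 1) → ℝ),
      |diagForm (fun i => w i * b i) x.1 * (α ^ 2 * diagForm (fun _ => 1) x.2 /
        (g * diagForm (fun _ => 1) x.2 + diagForm b x.1) ^ 2) +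
        2 * x.2 k ^ 2 * diagForm (fun i => w i * b i) x.1 *
          (α ^ 2 * (diagForm b x.1 - g * diagForm (fun _ => 1) x.2) /
            (g * diagForm (fun _ => 1) x.2 + diagForm b x.1) ^ 3)| ≤ 3 * (M * α ^ 2 / g) :=
    fun x => abs_deriv_sq_shrinkage_le hg (hB _) hM (hA _) (hAB _) (sq_nonneg _) (by
      simpa using le_diagForm (b := fun _ => 1) (fun _ => zero_le_one) x.2 k)
  have hint' : Integrable fun x : (Fin (m + 1) → ℝ) × (Fin (n + 1) → ℝ) => x.2 k *
      (x.2 k * (diagForm (fun i => w i * b i) x.1 * (α ^ 2 * diagForm (fun _ => 1) x.2 /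
        (g * diagForm (fun _ => 1) x.2 + diagForm b x.1) ^ 2))) *
        f (diagForm β (x.1 - θ) + diagForm (fun _ => τ) x.2) := by
    refine (hint.const_mul (M * α ^ 2 / g)).mono'
      (Measurable.aestronglyMeasurable (by fun_prop)) (Filter.Eventually.of_forall fun x => ?_)
    obtain ⟨h1, h2⟩ := sq_shrinkage_nonneg_le (α := α) hg (hS x.2) (hB x.1) hM (hA _) (hAB _)
    rw [← mul_assoc (x.2 k), ← sq, Real.norm_of_nonneg
      (mul_nonneg (mul_nonneg (sq_nonneg _) h1) (hf0 _)), mul_comm (x.2 k ^ 2), mul_assoc]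
    exact mul_le_mul_of_nonneg_right h2 (mul_nonneg (sq_nonneg _) (hf0 _))
  refine ⟨hint', htail.bdd_mul (Measurable.aestronglyMeasurable (by fun_prop))
    (Filter.Eventually.of_forall hK), ?_⟩
  refine integral_coord_mul_eq (e := sndCoordEquiv (Fin (m + 1) → ℝ) k)
    (ρ := fun ω => diagForm (fun _ => τ) ω.1 + diagForm β (ω.2 - θ))
    (y := fun x : (Fin (m + 1) → ℝ) × (Fin (n + 1) → ℝ) => x.2 k)
    (measurePreserving_sndCoordEquiv k) hf hf0 hτ ?_ ?_ (by fun_prop) hK ?_ hint hint' htail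
  · rintro t ⟨x, z⟩
    simp only [sndCoordEquiv_apply, diagForm_insertNth]
    ring
  · rintro t ⟨x, z⟩
    simp [sndCoordEquiv_apply]
  · have hae : ∀ᵐ ω : (Fin n → ℝ) × (Fin (m + 1) → ℝ), 0 < diagForm b ω.2 :=
      Measure.quasiMeasurePreserving_snd.ae (ae_diagForm_pos hb)
    filter_upwards [hae] with ω hω t
    obtain ⟨x, z⟩ := ω
    simp only [sndCoordEquiv_apply, diagForm_insertNth, Fin.insertNth_apply_same, one_mul]
    exact hasDerivAt_mul_sq_shrinkage hg (diagForm_nonneg (fun _ => zero_le_one) x) hω t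

lemma integral_shrinkage_nonpos (hf : Measurable f) (hf0 : ∀ t, 0 ≤ f t) (hb : ∀ i, 0 < b i)
    (hw : ∀ i, 0 ≤ w i) (hwM : ∀ i, w i ≤ M) (hβ : ∀ i, 0 < β i) (hτ : 0 < τ)
    (hα : 0 < α) (hg : 0 < g) (hM : M * (4 + α * ((n + 1 : ℕ) + 2)) ≤ 2 * ∑ i, w i)
    (hint0 : Integrable fun x : (Fin (m + 1) → ℝ) × (Fin (n + 1) → ℝ) =>
      f (diagForm β (x.1 - θ) + diagForm (fun _ => τ) x.2))
    (hint : ∀ i, Integrable fun x : (Fin (m + 1) → ℝ) × (Fin (n + 1) → ℝ) =>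
      (x.1 i - θ i) ^ 2 * f (diagForm β (x.1 - θ) + diagForm (fun _ => τ) x.2)) :
    ∫ x : (Fin (m + 1) → ℝ) × (Fin (n + 1) → ℝ),
      (-2 * ∑ i, w i * β i / τ * ((x.1 i - θ i) *
        (x.1 i * (α * diagForm (fun _ => 1) x.2 /
          (g * diagForm (fun _ => 1) x.2 + diagForm b x.1))) *
          f (diagForm β (x.1 - θ) + diagForm (fun _ => τ) x.2)) +
      ∑ k, x.2 k * (x.2 k * (diagForm (fun i => w i * b i) x.1 *
        (α ^ 2 * diagForm (fun _ => 1) x.2 /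
          (g * diagForm (fun _ => 1) x.2 + diagForm b x.1) ^ 2))) *
        f (diagForm β (x.1 - θ) + diagForm (fun _ => τ) x.2)) ≤ 0 := by
  have htail_ne : ∫⁻ x : (Fin (m + 1) → ℝ) × (Fin (n + 1) → ℝ),
      upperTail f (diagForm β (x.1 - θ) + diagForm (fun _ => τ) x.2) ≠ ⊤ := by
    rw [lintegral_upperTail_fst hf hβ 0]
    exact ENNReal.mul_ne_top ENNReal.ofReal_ne_top (hint 0).lintegral_lt_top.ne
  have htail : Integrable fun x : (Fin (m + 1) → ℝ) × (Fin (n + 1) → ℝ) =>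
      (upperTail f (diagForm β (x.1 - θ) + diagForm (fun _ => τ) x.2)).toReal :=
    integrable_toReal_of_lintegral_ne_top
      ((measurable_upperTail f).comp (by fun_prop)).aemeasurable htail_ne
  have hint_snd : ∀ k, Integrable fun x : (Fin (m + 1) → ℝ) × (Fin (n + 1) → ℝ) =>
      (x.2 k) ^ 2 * f (diagForm β (x.1 - θ) + diagForm (fun _ => τ) x.2) := by
    intro k
    rw [lintegral_upperTail_snd hf hτ k] at htail_ne
    refine (lintegral_ofReal_ne_top_iff_integrable
      (Measurable.aestronglyMeasurable (by fun_prop)) (Filter.Eventually.of_forall fun x =>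
        mul_nonneg (sq_nonneg _) (hf0 _))).1 fun htop => htail_ne ?_
    rw [htop]
    exact ENNReal.mul_top (by simpa using hτ)
  have hX := fun i => integral_fst_shrinkage (b := b) hf hf0 hb hβ hα hg i hint0 (hint i) htail
  have hZ := fun k => integral_snd_shrinkage (α := α) hf hf0 hb hw hwM hτ hg k (hint_snd k) htail
  have hXi := fun i => (hX i).2.1.const_mul (w i)
  have hZi := fun k => (hZ k).2.1
  rw [integral_add
      ((integrable_finsetSum _ fun i _ => (hX i).1.const_mul _).const_mul _)
      (integrable_finsetSum _ fun k _ => (hZ k).1), integral_const_mul,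
    integral_finsetSum _ (fun i _ => (hX i).1.const_mul _),
    integral_finsetSum _ (fun k _ => (hZ k).1)]
  simp_rw [integral_const_mul, (hX _).2.2, (hZ _).2.2]
  rw [← Finset.mul_sum, ← integral_finsetSum _ (fun k _ => hZi k)]
  have hβτ : ∀ i (I : ℝ), w i * β i / τ * (1 / (2 * β i) * I) = 1 / (2 * τ) * (w i * I) := by
    intro i I
    have := (hβ i).ne'
    field_simp
  simp_rw [hβτ, ← integral_const_mul (w _)]
  rw [← Finset.mul_sum, ← integral_finsetSum _ (fun i _ => hXi i), mul_left_comm, ← mul_add,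
    ← integral_const_mul, ← integral_add ((integrable_finsetSum _ fun i _ => hXi i).const_mul _)
      (integrable_finsetSum _ fun k _ => hZi k)]
  refine mul_nonpos_of_nonneg_of_nonpos (by positivity) (integral_nonpos fun x => ?_)
  have hdiv := shrinkage_divergence_nonpos (S := diagForm (fun _ => 1) x.2)
    (B := diagForm b x.1) (A := diagForm (fun i => w i * b i) x.1) hα hg
    (diagForm_nonneg (fun _ => zero_le_one) _) (diagForm_nonneg (fun i => (hb i).le) _)
    ((hw 0).trans (hwM 0)) (diagForm_nonneg (fun i => mul_nonneg (hw i) (hb i).le) _)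
    (diagForm_mul_le (fun i => (hb i).le) hwM _) (Nat.cast_nonneg (n + 1)) hM
  refine le_of_eq_of_le ?_ (mul_nonpos_of_nonpos_of_nonneg hdiv
    (ENNReal.toReal_nonneg (a := upperTail f
      (diagForm β (x.1 - θ) + diagForm (fun _ => τ) x.2))))
  generalize (upperTail f (diagForm β (x.1 - θ) + diagForm (fun _ => τ) x.2)).toReal = T
  generalize g * diagForm (fun _ => 1) x.2 + diagForm b x.1 = Q
  have e1 : ∑ i, w i * ((α * diagForm (fun _ => 1) x.2 / Q * (1 - 2 * (b i * x.1 i ^ 2) / Q)) * T)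
      = α * diagForm (fun _ => 1) x.2 / Q *
        (∑ i, w i - 2 * diagForm (fun i => w i * b i) x.1 / Q) * T := by
    conv_rhs => rw [diagForm.eq_1 (fun i => w i * b i)]
    rw [Finset.mul_sum, Finset.sum_div, ← Finset.sum_sub_distrib, Finset.mul_sum, Finset.sum_mul]
    exact Finset.sum_congr rfl fun i _ => by ring
  have e2 : ∀ P R A : ℝ, ∑ k, ((A * P + 2 * x.2 k ^ 2 * A * R) * T) =
      ((n + 1 : ℕ) * (A * P) + 2 * diagForm (fun _ => 1) x.2 * A * R) * T := by
    intro P R A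
    rw [← Finset.sum_mul, Finset.sum_add_distrib, ← Finset.sum_mul, ← Finset.sum_mul,
      ← Finset.sum_mul, ← Finset.mul_sum]
    simp [diagForm, mul_assoc]
  rw [e1, e2]
  ring

end Risk

lemma rpow_one_sub_natCast {d : ℝ} (hd : 0 < d) (j : ℕ) : d ^ ((1 : ℝ) - j) = d / d ^ j := by
  rw [Real.rpow_sub hd, Real.rpow_one, Real.rpow_natCast]

/-- Corollary 2.4: in the canonical spherically symmetric model, the simple estimator
`θ̂_SB = (I − (α/(γ(α+1) + W)) C^{-1}) X`, where `W = XᵀC^{-1}D^{-1}X/S` and `S = ZᵀZ`,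
dominates the least squares estimator `X` under the loss
`L_j(δ,θ,σ²) = (δ−θ)ᵀD^{-j}(δ−θ)/σ²`, provided
`0 < α ≤ (2/(n+2)) ((∑ d_i^{1−j}/c_i)/(max_i d_i^{1−j}/c_i) − 2)` and `γ ≥ 1`
(assuming the risk integrals are finite). -/
theorem stmt_8
    (p n : ℕ) (hp : 0 < p) (hn : 0 < n) (j : ℕ)
    (d c : Fin p → ℝ)
    (hd_pos : ∀ i, 0 < d i)
    (hd_mono : ∀ i k : Fin p, i ≤ k → d k ≤ d i)
    (hc : ∀ i, 1 ≤ c i)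
    (f : ℝ → ℝ) (hf_nonneg : ∀ t, 0 ≤ f t) (hf_meas : Measurable f)
    (α γ : ℝ) (hα : 0 < α) (hγ : 1 ≤ γ)
    (hα_bound : α ≤ 2 / ((n : ℝ) + 2) *
      ((∑ i, d i ^ ((1 : ℝ) - j) / c i) /
        (univ.sup' (univ_nonempty_iff.mpr (Fin.pos_iff_nonempty.mp hp))
          (fun i => d i ^ ((1 : ℝ) - j) / c i)) - 2))
    (θ : Fin p → ℝ) (σ : ℝ) (hσ : 0 < σ)
    (dens : ((Fin p → ℝ) × (Fin n → ℝ)) → ℝ)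
    (hdens : dens = fun q => (∏ i, (d i) ^ (-(1:ℝ)/2)) * σ ^ (-(p : ℝ) - n) *
      f (((∑ i, (q.1 i - θ i) ^ 2 / d i) + ∑ k, (q.2 k) ^ 2) / σ ^ 2))
    (hnorm : ∫ q, dens q = 1)
    (est : ((Fin p → ℝ) × (Fin n → ℝ)) → Fin p → ℝ)
    (hest : est = fun q i =>
      (1 - α / (γ * (α + 1) +
          (∑ i', (q.1 i') ^ 2 / (c i' * d i')) / (∑ k, (q.2 k) ^ 2)) / c i) * q.1 i)
    (h_int_est : Integrable (fun q => (∑ i, (est q i - θ i) ^ 2 / d i ^ j) / σ ^ 2 * dens q))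
    (h_int_ls : Integrable (fun q => (∑ i, (q.1 i - θ i) ^ 2 / d i ^ j) / σ ^ 2 * dens q)) :
    ∫ q, (∑ i, (est q i - θ i) ^ 2 / d i ^ j) / σ ^ 2 * dens q ≤
      ∫ q, (∑ i, (q.1 i - θ i) ^ 2 / d i ^ j) / σ ^ 2 * dens q := by
  obtain ⟨m, rfl⟩ : ∃ m, p = m + 1 := ⟨p - 1, by omega⟩
  obtain ⟨n, rfl⟩ : ∃ k, n = k + 1 := ⟨n - 1, by omega⟩
  have hc0 : ∀ i, 0 < c i := fun i => one_pos.trans_le (hc i)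
  have hg : 0 < γ * (α + 1) := by positivity
  set w : Fin (m + 1) → ℝ := fun i => d i ^ ((1 : ℝ) - j) / c i with hw_def
  set M := univ.sup' (univ_nonempty_iff.mpr (Fin.pos_iff_nonempty.mp hp)) w
  have hw : ∀ i, 0 < w i := fun i => div_pos (Real.rpow_pos_of_pos (hd_pos i) _) (hc0 i)
  have hwM : ∀ i, w i ≤ M := fun i => Finset.le_sup' w (Finset.mem_univ i)
  have hM0 : 0 < M := (hw 0).trans_le (hwM 0)
  have hbound : M * (4 + α * ((n + 1 : ℕ) + 2)) ≤ 2 * ∑ i, w i := by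
    have h2 : (0 : ℝ) < ((n + 1 : ℕ) : ℝ) + 2 := by positivity
    have h3 := mul_le_mul_of_nonneg_right hα_bound (mul_pos h2 hM0).le
    have h4 : 2 / (((n + 1 : ℕ) : ℝ) + 2) * ((∑ i, w i) / M - 2) *
        ((((n + 1 : ℕ) : ℝ) + 2) * M) = 2 * ∑ i, w i - 4 * M := by
      field_simp
      ring
    rw [h4] at h3
    linarith
  have hw_eq : ∀ i, w i = d i / d i ^ j / c i := fun i => by
    simp only [hw_def, rpow_one_sub_natCast (hd_pos i)]
  set κ := (∏ i, (d i) ^ (-(1:ℝ)/2)) * σ ^ (-((m + 1 : ℕ) : ℝ) - (n + 1 : ℕ))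
  have hκ : 0 < κ := mul_pos (Finset.prod_pos fun i _ => Real.rpow_pos_of_pos (hd_pos i) _)
    (Real.rpow_pos_of_pos hσ _)
  set b : Fin (m + 1) → ℝ := fun i => 1 / (c i * d i) with hb_def
  set β : Fin (m + 1) → ℝ := fun i => 1 / (d i * σ ^ 2) with hβ_def
  set τ : ℝ := 1 / σ ^ 2 with hτ_def
  have hb : ∀ i, 0 < b i := fun i => one_div_pos.2 (mul_pos (hc0 i) (hd_pos i))
  have hβ : ∀ i, 0 < β i := fun i => one_div_pos.2 (mul_pos (hd_pos i) (by positivity))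
  have hτ : 0 < τ := by positivity
  have hdens' : ∀ x, dens x = κ * f (diagForm β (x.1 - θ) + diagForm (fun _ => τ) x.2) := by
    intro x
    rw [hdens]
    simp only
    congr 2
    rw [add_div, Finset.sum_div, Finset.sum_div]
    simp only [diagForm, hβ_def, hτ_def, Pi.sub_apply]
    congr 1
    · exact Finset.sum_congr rfl fun i _ => by
        have := (hd_pos i).ne'
        field_simp
    · exact Finset.sum_congr rfl fun i _ => by field_simp
  have hB : ∀ x : Fin (m + 1) → ℝ, ∑ i, x i ^ 2 / (c i * d i) = diagForm b x := fun x =>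
    Finset.sum_congr rfl fun i _ => by simp only [hb_def]; ring
  have hS : ∀ z : Fin (n + 1) → ℝ, ∑ k, z k ^ 2 = diagForm (fun _ => 1) z := fun z => by
    simp [diagForm]
  have hint0 : Integrable fun x : (Fin (m + 1) → ℝ) × (Fin (n + 1) → ℝ) =>
      f (diagForm β (x.1 - θ) + diagForm (fun _ => τ) x.2) := by
    have h1 : Integrable dens := by
      by_contra h
      rw [integral_undef h] at hnorm
      exact zero_ne_one hnorm
    refine (h1.const_mul κ⁻¹).congr (Filter.Eventually.of_forall fun x => ?_)
    simp only [hdens']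
    field_simp
  have hint : ∀ i, Integrable fun x : (Fin (m + 1) → ℝ) × (Fin (n + 1) → ℝ) =>
      (x.1 i - θ i) ^ 2 * f (diagForm β (x.1 - θ) + diagForm (fun _ => τ) x.2) := by
    intro i
    refine (h_int_ls.const_mul (κ⁻¹ * σ ^ 2 * d i ^ j)).mono'
      (Measurable.aestronglyMeasurable (by fun_prop)) (Filter.Eventually.of_forall fun x => ?_)
    rw [Real.norm_of_nonneg (mul_nonneg (sq_nonneg _) (hf_nonneg _)), hdens']
    have hdi : 0 < d i ^ j := pow_pos (hd_pos i) j
    have h1 : (x.1 i - θ i) ^ 2 / d i ^ j ≤ ∑ i, (x.1 i - θ i) ^ 2 / d i ^ j :=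
      Finset.single_le_sum (f := fun i => (x.1 i - θ i) ^ 2 / d i ^ j)
        (fun i _ => div_nonneg (sq_nonneg _) (pow_pos (hd_pos i) j).le) (Finset.mem_univ i)
    rw [div_le_iff₀ hdi] at h1
    refine (mul_le_mul_of_nonneg_right h1 (hf_nonneg _)).trans (le_of_eq ?_)
    field_simp
  have hmain := integral_shrinkage_nonpos (M := M) hf_meas hf_nonneg hb (fun i => (hw i).le) hwM
    hβ hτ hα hg hbound hint0 hint
  rw [← sub_nonpos, ← integral_sub h_int_est h_int_ls]
  refine le_of_eq_of_le ?_ (mul_nonpos_of_nonneg_of_nonpos (mul_pos hκ hτ).le hmain)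
  rw [← integral_const_mul]
  refine integral_congr_ae ?_
  have hae : ∀ᵐ x : (Fin (m + 1) → ℝ) × (Fin (n + 1) → ℝ), 0 < diagForm (fun _ => 1) x.2 :=
    Measure.quasiMeasurePreserving_snd.ae (ae_diagForm_pos fun _ => one_pos)
  filter_upwards [hae] with x hx
  have hB0 : 0 ≤ diagForm b x.1 := diagForm_nonneg (fun i => (hb i).le) _
  have hφ : α / (γ * (α + 1) + diagForm b x.1 / diagForm (fun _ => 1) x.2) =
      α * diagForm (fun _ => 1) x.2 /
        (γ * (α + 1) * diagForm (fun _ => 1) x.2 + diagForm b x.1) := by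
    field_simp
  simp only [hest, hdens', hB, hS, hφ]
  have hsq : ∀ ψ F : ℝ, ∑ k, x.2 k * (x.2 k * ψ) * F = diagForm (fun _ => 1) x.2 * ψ * F := by
    intro ψ F
    rw [← hS, Finset.sum_mul, Finset.sum_mul]
    exact Finset.sum_congr rfl fun k _ => by ring
  rw [hsq]
  generalize f (diagForm β (x.1 - θ) + diagForm (fun _ => τ) x.2) = F
  have hA : diagForm (fun _ => 1) x.2 * (diagForm (fun i => w i * b i) x.1 *
      (α ^ 2 * diagForm (fun _ => 1) x.2 /
        (γ * (α + 1) * diagForm (fun _ => 1) x.2 + diagForm b x.1) ^ 2)) =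
      diagForm (fun i => w i * b i) x.1 * (α * diagForm (fun _ => 1) x.2 /
        (γ * (α + 1) * diagForm (fun _ => 1) x.2 + diagForm b x.1)) ^ 2 := by
    rw [div_pow]
    ring
  rw [hA]
  generalize α * diagForm (fun _ => 1) x.2 /
    (γ * (α + 1) * diagForm (fun _ => 1) x.2 + diagForm b x.1) = φ
  rw [← sub_mul, ← sub_div, ← Finset.sum_sub_distrib, diagForm, Finset.mul_sum, Finset.sum_mul,
    Finset.sum_mul, ← Finset.sum_add_distrib, Finset.mul_sum, Finset.sum_div, Finset.sum_mul]
  refine Finset.sum_congr rfl fun i _ => ?_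
  have hdi := (hd_pos i).ne'
  have hci := (hc0 i).ne'
  rw [hw_eq]
  simp only [hβ_def, hτ_def, hb_def]
  field_simp
  ring
end

section
/- Let d₁ ≥ d₂ ≥ … ≥ d_p > 0 and 1 ≤ c₁ ≤ c₂ ≤ … ≤ c_p, and let 0 ≤ t₀ < 1 satisfy t₀ ≤ min_{1 ≤ j < i ≤ p} [ c_i c_j (d₁ d_j − d_i d_p) / (c_i d₁ d_j − c_j d_i d_p) ] (the denominators c_i d₁ d_j − c_j d_i d_p being positive). Then for every t with 0 ≤ t ≤ t₀, ( max_{1≤i≤p} d_i (1 − t/c_i) ) / ( min_{1≤i≤p} d_i (1 − t/c_i) ) ≤ d₁/d_p. -/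
open Finset

/-- Clearing denominators in the bound on `t`: a product inequality between shrunken values. -/
theorem mul_one_sub_div_le_of_le_div {a b u v t : ℝ} (hu : 0 < u) (hv : 0 < v)
    (hden : 0 < u * b - v * a) (ht : t ≤ u * v * (b - a) / (u * b - v * a)) :
    a * (1 - t / u) ≤ b * (1 - t / v) := by
  rw [le_div_iff₀ hden] at ht
  have key : b * (1 - t / v) - a * (1 - t / u)
      = (u * v * (b - a) - t * (u * b - v * a)) / (u * v) := by
    field_simp
    ring
  have : 0 ≤ (u * v * (b - a) - t * (u * b - v * a)) / (u * v) :=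
    div_nonneg (by linarith) (by positivity)
  linarith

/-- Theorem 3.1(i): if `d₁ ≥ … ≥ d_p > 0`, `1 ≤ c₁ ≤ … ≤ c_p`, and
`0 ≤ t₀ < 1` satisfies `t₀ ≤ c_i c_j (d₁ d_j − d_i d_p)/(c_i d₁ d_j − c_j d_i d_p)`
for all `j < i` (with positive denominators), then for every `0 ≤ t ≤ t₀` the
condition number `max_i d_i(1 − t/c_i) / min_i d_i(1 − t/c_i)` is at most `d₁/d_p`. -/
theorem stmt_10 (p : ℕ) (hp : 0 < p) (d c : Fin p → ℝ)
    (hd_pos : ∀ i, 0 < d i)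
    (hd_mono : ∀ i k : Fin p, i ≤ k → d k ≤ d i)
    (hc_one : ∀ i, 1 ≤ c i)
    (hc_mono : Monotone c)
    (t₀ : ℝ) (ht₀_nonneg : 0 ≤ t₀) (ht₀_lt : t₀ < 1)
    (hden : ∀ i k : Fin p, k < i →
      0 < c i * d ⟨0, hp⟩ * d k - c k * d i * d ⟨p - 1, by omega⟩)
    (ht₀ : ∀ i k : Fin p, k < i →
      t₀ ≤ c i * c k * (d ⟨0, hp⟩ * d k - d i * d ⟨p - 1, by omega⟩) /
            (c i * d ⟨0, hp⟩ * d k - c k * d i * d ⟨p - 1, by omega⟩))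
    (t : ℝ) (ht_nonneg : 0 ≤ t) (ht_le : t ≤ t₀) :
    (univ.sup' (univ_nonempty_iff.mpr (Fin.pos_iff_nonempty.mp hp))
        (fun i => d i * (1 - t / c i))) /
      (univ.inf' (univ_nonempty_iff.mpr (Fin.pos_iff_nonempty.mp hp))
        (fun i => d i * (1 - t / c i)))
      ≤ d ⟨0, hp⟩ / d ⟨p - 1, by omega⟩ := by
  have hc_pos : ∀ i, 0 < c i := fun i => one_pos.trans_le (hc_one i)
  have hfac : ∀ i, 0 < 1 - t / c i := fun i => by
    rw [sub_pos, div_lt_one (hc_pos i)]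
    linarith [hc_one i]
  set D := d ⟨0, hp⟩
  set e := d ⟨p - 1, by omega⟩
  have hD_pos : 0 < D := hd_pos _
  have he_pos : 0 < e := hd_pos _
  have hle_D : ∀ i, d i ≤ D := fun i => hd_mono _ _ (Fin.mk_le_of_le_val (Nat.zero_le _))
  have he_le : ∀ i, e ≤ d i := fun i => hd_mono _ _ (Fin.le_def.mpr (by simp only; omega))
  have hpair : ∀ i k, d i * (1 - t / c i) * e ≤ D * (d k * (1 - t / c k)) := by
    intro i k
    rcases lt_or_ge k i with hki | hik
    · have h := mul_one_sub_div_le_of_le_div (a := d i * e) (b := D * d k) (t := t)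
        (hc_pos i) (hc_pos k) (by linarith [hden i k hki])
        (by
          have := ht_le.trans (ht₀ i k hki)
          rwa [mul_assoc (c i) D, mul_assoc (c k) (d i)] at this)
      linarith
    · have hshrink : 1 - t / c i ≤ 1 - t / c k :=
        sub_le_sub_left (div_le_div_of_nonneg_left ht_nonneg (hc_pos i) (hc_mono hik)) 1
      calc d i * (1 - t / c i) * e ≤ D * (1 - t / c k) * d k := by
            have := (hfac i).le
            have := (hfac k).le
            have := hle_D i
            have := he_le k
            gcongr
        _ = D * (d k * (1 - t / c k)) := by ring
  obtain ⟨i, -, hi⟩ := exists_mem_eq_sup' (univ_nonempty_iff.mpr (Fin.pos_iff_nonempty.mp hp))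
    (fun i => d i * (1 - t / c i))
  obtain ⟨k, -, hk⟩ := exists_mem_eq_inf' (univ_nonempty_iff.mpr (Fin.pos_iff_nonempty.mp hp))
    (fun i => d i * (1 - t / c i))
  rw [hi, hk, div_le_div_iff₀ (mul_pos (hd_pos k) (hfac k)) he_pos]
  exact hpair i k
end

section
/- Let d₁ ≥ d₂ ≥ … ≥ d_p > 0 and suppose c_p > c₁ ≥ c₂ ≥ … ≥ c_{p−1} ≥ 1, and let 0 ≤ t₀ < 1 satisfy t₀ ≤ min( c₁ c_{p−1} (d_{p−1} − d_p) / (c₁ d_{p−1} − c_{p−1} d_p), c_{p−1} c_p (d₁ d_{p−1} − d_p²) / (c_p d₁ d_{p−1} − c_{p−1} d_p²) ) (the denominators being positive). Then for every t with 0 ≤ t ≤ t₀, ( max_{1≤i≤p} d_i (1 − t/c_i) ) / ( min_{1≤i≤p} d_i (1 − t/c_i) ) ≤ d₁/d_p. -/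
open Finset

/-- A shrinkage value below the crossing point of the lines `t ↦ y * (1 - t / a)` and
`t ↦ x * (1 - t / b)` keeps the first line below the second. -/
theorem mul_one_sub_div_le_of_le_crossing {a b x y t : ℝ} (ha : 0 < a) (hb : 0 < b)
    (hden : 0 < a * x - b * y) (ht : t ≤ a * b * (x - y) / (a * x - b * y)) :
    y * (1 - t / a) ≤ x * (1 - t / b) := by
  rw [le_div_iff₀ hden] at ht
  have key : x * (1 - t / b) - y * (1 - t / a) =
      (a * b * (x - y) - t * (a * x - b * y)) / (a * b) := by
    field_simp
    ring
  have : 0 ≤ (a * b * (x - y) - t * (a * x - b * y)) / (a * b) :=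
    div_nonneg (sub_nonneg.mpr ht) (mul_pos ha hb).le
  linarith

/-- The condition number of a positive family is at most `r / s` as soon as every pairwise
quotient is. -/
theorem sup'_div_inf'_le_of_forall_mul_le {ι : Type*} {S : Finset ι} (hS : S.Nonempty)
    {f : ι → ℝ} {r s : ℝ} (hs : 0 < s) (hf : ∀ i ∈ S, 0 < f i)
    (h : ∀ i ∈ S, ∀ j ∈ S, s * f i ≤ r * f j) :
    S.sup' hS f / S.inf' hS f ≤ r / s := by
  obtain ⟨i, hi, hi_eq⟩ := S.exists_mem_eq_sup' hS f
  obtain ⟨j, hj, hj_eq⟩ := S.exists_mem_eq_inf' hS f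
  rw [hi_eq, hj_eq, div_le_div_iff₀ (hf j hj) hs, mul_comm (f i)]
  exact h i hi j hj

/-- Theorem 3.1(ii): if `d₁ ≥ … ≥ d_p > 0`, `c_p > c₁ ≥ c₂ ≥ … ≥ c_{p−1} ≥ 1`,
and `0 ≤ t₀ < 1` satisfies
`t₀ ≤ min( c₁ c_{p−1}(d_{p−1} − d_p)/(c₁ d_{p−1} − c_{p−1} d_p),
           c_{p−1} c_p (d₁ d_{p−1} − d_p²)/(c_p d₁ d_{p−1} − c_{p−1} d_p²) )`
(with positive denominators), then for every `0 ≤ t ≤ t₀` the condition number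
`max_i d_i(1 − t/c_i) / min_i d_i(1 − t/c_i)` is at most `d₁/d_p`.
(Here `d₁, d_{p−1}, d_p` are the entries of index `0, p−2, p−1`.) -/
theorem stmt_11 (p : ℕ) (hp : 2 ≤ p) (d c : Fin p → ℝ)
    (hd_pos : ∀ i, 0 < d i)
    (hd_mono : ∀ i k : Fin p, i ≤ k → d k ≤ d i)
    (hc_one : ∀ i, 1 ≤ c i)
    -- `c₁ ≥ c₂ ≥ … ≥ c_{p−1}` : antitone on the indices `0, …, p−2`
    (hc_anti : ∀ i k : Fin p, i ≤ k → (k : ℕ) + 1 < p → c k ≤ c i)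
    -- `c_p > c₁`
    (hc_last : c ⟨0, by omega⟩ < c ⟨p - 1, by omega⟩)
    (t₀ : ℝ) (ht₀_nonneg : 0 ≤ t₀) (ht₀_lt : t₀ < 1)
    (hden1 : 0 < c ⟨0, by omega⟩ * d ⟨p - 2, by omega⟩ -
      c ⟨p - 2, by omega⟩ * d ⟨p - 1, by omega⟩)
    (hden2 : 0 < c ⟨p - 1, by omega⟩ * d ⟨0, by omega⟩ * d ⟨p - 2, by omega⟩ -
      c ⟨p - 2, by omega⟩ * d ⟨p - 1, by omega⟩ ^ 2)
    (ht₀ : t₀ ≤ min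
      (c ⟨0, by omega⟩ * c ⟨p - 2, by omega⟩ *
          (d ⟨p - 2, by omega⟩ - d ⟨p - 1, by omega⟩) /
        (c ⟨0, by omega⟩ * d ⟨p - 2, by omega⟩ -
          c ⟨p - 2, by omega⟩ * d ⟨p - 1, by omega⟩))
      (c ⟨p - 2, by omega⟩ * c ⟨p - 1, by omega⟩ *
          (d ⟨0, by omega⟩ * d ⟨p - 2, by omega⟩ - d ⟨p - 1, by omega⟩ ^ 2) /
        (c ⟨p - 1, by omega⟩ * d ⟨0, by omega⟩ * d ⟨p - 2, by omega⟩ -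
          c ⟨p - 2, by omega⟩ * d ⟨p - 1, by omega⟩ ^ 2)))
    (t : ℝ) (ht_nonneg : 0 ≤ t) (ht_le : t ≤ t₀) :
    (univ.sup' (univ_nonempty_iff.mpr ⟨⟨0, by omega⟩⟩)
        (fun i => d i * (1 - t / c i))) /
      (univ.inf' (univ_nonempty_iff.mpr ⟨⟨0, by omega⟩⟩)
        (fun i => d i * (1 - t / c i)))
      ≤ d ⟨0, by omega⟩ / d ⟨p - 1, by omega⟩ := by
  have hc_pos : ∀ i, 0 < c i := fun i => one_pos.trans_le (hc_one i)
  have hfac_pos : ∀ i, 0 < 1 - t / c i := fun i => by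
    rw [sub_pos, div_lt_one (hc_pos i)]
    linarith [hc_one i]
  have hfac_mono : ∀ i k, c i ≤ c k → 1 - t / c i ≤ 1 - t / c k := fun i k h =>
    sub_le_sub_left (div_le_div_of_nonneg_left ht_nonneg (hc_pos i) h) 1
  obtain ⟨ht₁, ht₂⟩ := le_min_iff.mp (ht_le.trans ht₀)
  have hcross₁ := mul_one_sub_div_le_of_le_crossing (hc_pos _) (hc_pos _) hden1 ht₁
  rw [mul_assoc (c ⟨p - 1, by omega⟩)] at hden2 ht₂
  rw [mul_comm (c ⟨p - 2, by omega⟩) (c ⟨p - 1, by omega⟩)] at ht₂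
  have hcross₂ := mul_one_sub_div_le_of_le_crossing (hc_pos _) (hc_pos _) hden2 ht₂
  have hfac_last := hfac_mono _ _ hc_last.le
  have hd_last := hd_mono ⟨0, by omega⟩ ⟨p - 1, by omega⟩ (Fin.mk_le_mk.mpr (Nat.zero_le _))
  have hcases : ∀ i : Fin p, i = ⟨p - 1, by omega⟩ ∨ (i : ℕ) + 1 < p := fun i => by
    rw [Fin.ext_iff]
    have := i.isLt
    dsimp only
    omega
  have hupper : ∀ i : Fin p, (i : ℕ) + 1 < p →
      d i * (1 - t / c i) ≤ d ⟨0, by omega⟩ * (1 - t / c ⟨0, by omega⟩) := fun i hi =>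
    have h0 : (⟨0, by omega⟩ : Fin p) ≤ i := Fin.mk_le_of_le_val (Nat.zero_le _)
    mul_le_mul (hd_mono _ _ h0) (hfac_mono _ _ (hc_anti _ _ h0 hi)) (hfac_pos i).le
      (hd_pos _).le
  have hlower : ∀ j : Fin p, (j : ℕ) + 1 < p →
      d ⟨p - 2, by omega⟩ * (1 - t / c ⟨p - 2, by omega⟩) ≤ d j * (1 - t / c j) := fun j hj =>
    have hj' : j ≤ ⟨p - 2, by omega⟩ := Fin.mk_le_mk.mpr (by omega)
    mul_le_mul (hd_mono _ _ hj') (hfac_mono _ _ (hc_anti _ _ hj' (by dsimp only; omega)))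
      (hfac_pos _).le (hd_pos _).le
  have hd₁ := hd_pos ⟨0, by omega⟩
  have hdp := hd_pos ⟨p - 1, by omega⟩
  refine sup'_div_inf'_le_of_forall_mul_le _ hdp
    (fun i _ => mul_pos (hd_pos i) (hfac_pos i)) fun i _ j _ => ?_
  rcases hcases i with rfl | hi <;> rcases hcases j with rfl | hj
  · exact mul_le_mul_of_nonneg_right hd_last (mul_pos hdp (hfac_pos _)).le
  · have := mul_le_mul_of_nonneg_left (hlower j hj) hd₁.le
    linarith
  · have := mul_le_mul_of_nonneg_left (hupper i hi) hdp.le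
    have := mul_le_mul_of_nonneg_left hfac_last (mul_pos hd₁ hdp).le
    linarith
  · have := mul_le_mul_of_nonneg_left (hupper i hi) hdp.le
    have := mul_le_mul_of_nonneg_left (hcross₁.trans (hlower j hj)) hd₁.le
    linarith
end
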